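/- arXiv:2012.06412 — 5 statements merged into one kernel-verified Lean document; each statement's English description precedes it below -/
import Mathlib

section
/- Let n be a positive integer and let w∈B_n. Write w=μ∘π where μ∈B_n is the unique signed permutation with μ_1<μ_2<⋯<μ_n whose entry set equals {w_1,…,w_n} and π∈S_n is the standardization of w (so w_i=μ_{π_i} for all i). Let N:={−w_i : w_i<0}⊆{1,…,n} be the set of absolute values of the negative entries of w. Then w is fully commutative if and only if π is 321-avoiding and one of the following holds: (a) 1∉Des(π^{-1}) and N⊆{1,…,v(π)}; (b) 1∈Des(π^{-1}), #N≤1 and N⊆{1,…,v(π)}. -/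
open scoped Classical

noncomputable section

namespace Paper

/-- Membership in the hyperoctahedral group `B_n`, realized inside `Equiv.Perm ℤ`:
`w(-i) = -w(i)` and `w` fixes every integer of absolute value larger than `n`. -/
def InB (n : ℕ) (w : Equiv.Perm ℤ) : Prop :=
  (∀ i : ℤ, w (-i) = - w i) ∧ ∀ i : ℤ, (n : ℤ) < |i| → w i = i

/-- Window entry `w_i` with the convention `w_0 = 0`. -/
def went (w : Equiv.Perm ℤ) (i : ℕ) : ℤ := if i = 0 then 0 else w (i : ℤ)

/-- Stembridge's pattern criterion: `w ∈ B_n` is fully commutative iff there are no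
indices `i<j` with `0 > w_i > w_j`, no `i<j<k` with `|w_i| > w_j > w_k`, and no
`i<j<k` with `-w_j > |w_i| > w_k`. -/
def IsFC (n : ℕ) (w : Equiv.Perm ℤ) : Prop :=
  InB n w ∧
  (¬ ∃ i j : ℕ, 1 ≤ i ∧ i < j ∧ j ≤ n ∧ w (j : ℤ) < w (i : ℤ) ∧ w (i : ℤ) < 0) ∧
  (¬ ∃ i j k : ℕ, 1 ≤ i ∧ i < j ∧ j < k ∧ k ≤ n ∧
      w (j : ℤ) < |w (i : ℤ)| ∧ w (k : ℤ) < w (j : ℤ)) ∧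
  (¬ ∃ i j k : ℕ, 1 ≤ i ∧ i < j ∧ j < k ∧ k ≤ n ∧
      |w (i : ℤ)| < - w (j : ℤ) ∧ w (k : ℤ) < |w (i : ℤ)|)

/-- Membership in `S_n ⊆ B_n`: all window entries positive. -/
def InS (n : ℕ) (w : Equiv.Perm ℤ) : Prop :=
  InB n w ∧ ∀ i : ℕ, 1 ≤ i → i ≤ n → 0 < w (i : ℤ)

/-- 321-avoidance of the window. -/
def Avoids321 (n : ℕ) (w : Equiv.Perm ℤ) : Prop :=
  ¬ ∃ i j k : ℕ, 1 ≤ i ∧ i < j ∧ j < k ∧ k ≤ n ∧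
    w (k : ℤ) < w (j : ℤ) ∧ w (j : ℤ) < w (i : ℤ)

/-- Type-B descent set `Des_B(w) = {0 ≤ i ≤ n-1 : w_i > w_{i+1}}`, convention `w_0 = 0`. -/
def DesB (n : ℕ) (w : Equiv.Perm ℤ) : Finset ℕ :=
  (Finset.range n).filter fun i => went w (i+1) < went w i

/-- Type-A descent set `Des(w) = {1 ≤ i ≤ n-1 : w_i > w_{i+1}}`. -/
def DesA (n : ℕ) (w : Equiv.Perm ℤ) : Finset ℕ :=
  (Finset.Ico 1 n).filter fun i => went w (i+1) < went w i

/-- Last descent: `ldes(w) = max (Des_B(w) ∪ {0})`. -/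
def ldes (n : ℕ) (w : Equiv.Perm ℤ) : ℕ := (DesB n w).sup id

/-- `Neg(w) = {1 ≤ i ≤ n : w_i < 0}`. -/
def NegSet (n : ℕ) (w : Equiv.Perm ℤ) : Finset ℕ :=
  (Finset.Icc 1 n).filter fun i => w (i : ℤ) < 0

/-- Block number `bl(w) = 1 + #{1 ≤ i ≤ n-1 : max(w_1,…,w_i) < min(w_{i+1},…,w_n)}`. -/
def bl (n : ℕ) (w : Equiv.Perm ℤ) : ℕ :=
  1 + ((Finset.Ioo 0 n).filter fun i : ℕ =>
    ∀ j ∈ Finset.Icc 1 i, ∀ k ∈ Finset.Icc (i + 1) n, w ((j : ℕ) : ℤ) < w ((k : ℕ) : ℤ)).card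

/-- Chow's type-B fundamental quasi-symmetric function `F^B_J` in variables `x_0,x_1,…`:
the sum of `x_{i_1} ⋯ x_{i_n}` over `0 ≤ i_1 ≤ ⋯ ≤ i_n` with `i_j < i_{j+1}` for `j ∈ J`,
with the convention `i_0 = 0`. A sequence is encoded by `f : ℕ → ℕ` with `f a = i_a`
for `1 ≤ a ≤ n`, normalized by `f 0 = 0` and `f a = 0` for `a > n`. -/
def FB (R : Type) [CommRing R] (n : ℕ) (J : Finset ℕ) : MvPowerSeries ℕ R :=
  fun m => (Nat.card {f : ℕ → ℕ //
    f 0 = 0 ∧ (∀ a, n < a → f a = 0) ∧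
    (∀ a b, a ≤ b → b ≤ n → f a ≤ f b) ∧
    (∀ j ∈ J, f j < f (j + 1)) ∧
    ∀ v : ℕ, m v = ((Finset.Icc 1 n).filter fun a => f a = v).card} : R)

/-- Gessel's fundamental quasi-symmetric function `F_J` in variables `x_1,x_2,…`. -/
def FA (R : Type) [CommRing R] (n : ℕ) (J : Finset ℕ) : MvPowerSeries ℕ R :=
  fun m => (Nat.card {f : ℕ → ℕ //
    f 0 = 0 ∧ (∀ a, n < a → f a = 0) ∧
    (∀ a, 1 ≤ a → a ≤ n → 1 ≤ f a) ∧
    (∀ a b, 1 ≤ a → a ≤ b → b ≤ n → f a ≤ f b) ∧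
    (∀ j ∈ J, f j < f (j + 1)) ∧
    ∀ v : ℕ, m v = ((Finset.Icc 1 n).filter fun a => f a = v).card} : R)

/-- Complete homogeneous symmetric function `h_m` in the variables `x_s, x_{s+1}, …`. -/
def hSeries (R : Type) [CommRing R] (s m : ℕ) : MvPowerSeries ℕ R :=
  fun μ => if (μ.sum fun _ v => v) = m ∧ ∀ a < s, μ a = 0 then 1 else 0

/-- Number of semistandard Young tableaux of shape `lam` (row lengths `lam 0 ≥ lam 1 ≥ …`),
with all entries `≥ s`, rows weakly increasing, columns strictly increasing,
and content `μ` (the value `v` occurs `μ v` times). Tableaux are normalized to be `0`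
outside the cells of the diagram. -/
def schurCoeff (s : ℕ) (lam : ℕ → ℕ) (μ : ℕ → ℕ) : ℕ :=
  Nat.card {T : ℕ → ℕ → ℕ //
    (∀ i j, j + 1 < lam i → T i j ≤ T i (j + 1)) ∧
    (∀ i j, j < lam (i + 1) → T i j < T (i + 1) j) ∧
    (∀ i j, j < lam i → s ≤ T i j) ∧
    (∀ i j, ¬ j < lam i → T i j = 0) ∧
    ∀ v : ℕ, μ v = Nat.card {p : ℕ × ℕ // p.2 < lam p.1 ∧ T p.1 p.2 = v}}

/-- The Schur function `s_lam` in the variables `x_s, x_{s+1}, …`. -/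
def schurS (R : Type) [CommRing R] (s : ℕ) (lam : ℕ → ℕ) : MvPowerSeries ℕ R :=
  fun m => (schurCoeff s lam (fun v => m v) : R)

/-- The two-row shape `(a, b)` as a row-length function. -/
def twoRow (a b : ℕ) : ℕ → ℕ := fun i => if i = 0 then a else if i = 1 then b else 0

/-- Row-length function of a partition of `k`. -/
def partFun {k : ℕ} (p : Nat.Partition k) : ℕ → ℕ :=
  fun i => ((p.parts.sort (· ≤ ·)).reverse).getD i 0

/-- Conjugate of a row-length function. -/
def conjFun (lam : ℕ → ℕ) : ℕ → ℕ := fun j => Nat.card {i : ℕ // j < lam i}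

/-- Descent set of the standard Young tableau of skew shape `(n,k)/(k)` (resp. of the
bi-tableau of bi-shape `((k),(n-k))`) encoded by the set `S ⊆ {1,…,n}` of entries of the
length-`k` bottom row: `{1 ≤ i ≤ n-1 : i ∉ S, i+1 ∈ S}`. -/
def DesSet (n : ℕ) (S : Finset ℕ) : Finset ℕ :=
  (Finset.Ico 1 n).filter fun i => i ∉ S ∧ i + 1 ∈ S

/-- Last descent of the tableau encoded by `S`. -/
def ldesSet (n : ℕ) (S : Finset ℕ) : ℕ := (DesSet n S).sup id

/-- Type-B descent set of the bi-tableau encoded by `S`: add `0` when `1 ∈ S`. -/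
def DesBSet (n : ℕ) (S : Finset ℕ) : Finset ℕ :=
  if 1 ∈ S then insert 0 (DesSet n S) else DesSet n S

/-- `b_{n,k,j}`: the number of standard Young tableaux of skew shape `(n,k)/(k)`
(encoded by `k`-subsets `S ⊆ {1,…,n}`) with `ldes = n - j`. -/
def bCoeff (n k j : ℕ) : ℕ :=
  ((Finset.Icc 1 n).powerset.filter fun S => S.card = k ∧ ldesSet n S = n - j).card

/-- `a_{n,k,j}`: the number of standard Young tableaux of shape `(n-k,k)` (encoded by
`k`-subsets `S ⊆ {1,…,n}` of second-row entries satisfying the ballot condition)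
with `ldes = n - j`. -/
def aCoeff (n k j : ℕ) : ℕ :=
  ((Finset.Icc 1 n).powerset.filter fun S => S.card = k ∧
    (∀ i ∈ Finset.Icc 1 n, 2 * (S.filter (· ≤ i)).card ≤ i) ∧ ldesSet n S = n - j).card

/-- `e_{n,m,J}`: number of `m`-subsets `S ⊆ {1,…,n}` with `Des_B(S) = J`. -/
def eCoeff (n m : ℕ) (J : Finset ℕ) : ℕ :=
  ((Finset.Icc 1 n).powerset.filter fun S => S.card = m ∧ DesBSet n S = J).card

/-- `d_{n,m,j}`: number of `m`-subsets `S ⊆ {1,…,n}` with `ldes(S) = n - j`. -/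
def dCoeff (n m j : ℕ) : ℕ :=
  ((Finset.Icc 1 n).powerset.filter fun S => S.card = m ∧ ldesSet n S = n - j).card

/-- The palindromic representation `w^0 = [-w_n, …, -w_1, w_1, …, w_n]`,
as a function of the position `p ∈ {1,…,2n}`. -/
def wzero (n : ℕ) (w : Equiv.Perm ℤ) : ℕ → ℤ :=
  fun p => if p ≤ n then - w ((n : ℤ) + 1 - (p : ℤ)) else w ((p : ℤ) - (n : ℤ))

/-- Greene invariant: the maximal total size of a union of `j` increasing subsequences
of `w^0` (a set of positions is such a union iff it admits a coloring by `j` colors with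
each color class increasing). By Greene's theorem this equals `λ_1 + ⋯ + λ_j` for the
RSK shape `λ(w^0)`. -/
def greene (n : ℕ) (w : Equiv.Perm ℤ) (j : ℕ) : ℕ :=
  ((Finset.Icc 1 (2 * n)).powerset.filter fun P =>
    ∃ c : ℕ → Fin j, ∀ p ∈ P, ∀ q ∈ P, p < q → c p = c q →
      wzero n w p < wzero n w q).sup Finset.card

/-- First valley `v(π)`. -/
def firstValley (n : ℕ) (π : Equiv.Perm ℤ) : ℕ :=
  if h : ((DesA n π⁻¹).erase 1).Nonempty then ((DesA n π⁻¹).erase 1).min' h else n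

/-- Order key for the order `-1 <r -2 <r ⋯ <r -n <r 1 <r ⋯ <r n`. -/
def rkey (n : ℕ) (a : ℤ) : ℤ := if a < 0 then -a else a + n

/-- The r-descent set `rDes(w) = {1 ≤ i ≤ n-1 : w_i >r w_{i+1}}`. -/
def rDes (n : ℕ) (w : Equiv.Perm ℤ) : Finset ℕ :=
  (Finset.Ico 1 n).filter fun i : ℕ =>
    rkey n (w (((i : ℕ) + 1 : ℕ) : ℤ)) < rkey n (w ((i : ℕ) : ℤ))

/-- Poirier's type-B quasi-symmetric function `F^P_w(X,Y)`, a power series in the two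
alphabets `x_1,x_2,…` (indexed by `Sum.inl`) and `y_1,y_2,…` (indexed by `Sum.inr`). -/
def FP (n : ℕ) (w : Equiv.Perm ℤ) : MvPowerSeries (ℕ ⊕ ℕ) ℤ :=
  fun m => (Nat.card {f : ℕ → ℕ //
    f 0 = 0 ∧ (∀ a, n < a → f a = 0) ∧
    (∀ a, 1 ≤ a → a ≤ n → 1 ≤ f a) ∧
    (∀ a b, 1 ≤ a → a ≤ b → b ≤ n → f a ≤ f b) ∧
    (∀ j ∈ rDes n w, f j < f (j + 1)) ∧
    (∀ v : ℕ, m (Sum.inl v) =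
      ((Finset.Icc 1 n).filter fun a => f a = v ∧ 0 < w ((a : ℕ) : ℤ)).card) ∧
    ∀ v : ℕ, m (Sum.inr v) =
      ((Finset.Icc 1 n).filter fun a => f a = v ∧ w ((a : ℕ) : ℤ) < 0).card} : ℤ)

/-- The Schur function `s_lam(X)` in the first alphabet `x_1,x_2,…`. -/
def schurX (lam : ℕ → ℕ) : MvPowerSeries (ℕ ⊕ ℕ) ℤ :=
  fun m => if ∀ v, m (Sum.inr v) = 0 then
    (schurCoeff 1 lam fun v => m (Sum.inl v) : ℤ) else 0

/-- The Schur function `s_lam(Y)` in the second alphabet `y_1,y_2,…`. -/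
def schurY (lam : ℕ → ℕ) : MvPowerSeries (ℕ ⊕ ℕ) ℤ :=
  fun m => if ∀ v, m (Sum.inl v) = 0 then
    (schurCoeff 1 lam fun v => m (Sum.inr v) : ℤ) else 0

/-- Chow type-B Schur-positivity: a nonnegative combination of the products
`s_{λ⁻}(x_1,x_2,…) ⋅ s_{λ⁺}(x_0,x_1,…)` over pairs of partitions of total size `n`. -/
def ChowPos (n : ℕ) (F : MvPowerSeries ℕ ℤ) : Prop :=
  ∃ c : (Σ k : Fin (n + 1), Nat.Partition (k : ℕ) × Nat.Partition (n - (k : ℕ))) → ℕ,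
    F = ∑ p : (Σ k : Fin (n + 1), Nat.Partition (k : ℕ) × Nat.Partition (n - (k : ℕ))),
      (c p : ℤ) • (schurS ℤ 1 (partFun p.2.1) * schurS ℤ 0 (partFun p.2.2))

/-- Signed permutations act on the nonzero integers of absolute value at most `n`. -/
lemma InB.abs_bounds {n : ℕ} {w : Equiv.Perm ℤ} (hw : InB n w) {i : ℤ} (h0 : i ≠ 0)
    (hi : |i| ≤ n) : w i ≠ 0 ∧ |w i| ≤ n := by
  have hz : w 0 = 0 := by have := hw.1 0; simp at this; omega
  refine ⟨fun h => h0 (w.injective (h.trans hz.symm)), ?_⟩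
  by_contra! h
  have := w.injective (hw.2 _ h)
  rw [this] at h
  omega

lemma InB.inv {n : ℕ} {w : Equiv.Perm ℤ} (hw : InB n w) : InB n w⁻¹ := by
  refine ⟨fun i => ?_, fun i hi => ?_⟩
  · rw [Equiv.Perm.inv_eq_iff_eq, hw.1, ← Equiv.Perm.inv_eq_iff_eq.1 rfl]
  · rw [Equiv.Perm.inv_eq_iff_eq, hw.2 i hi]

lemma InS.bounds {n : ℕ} {π : Equiv.Perm ℤ} (hπ : InS n π) {i : ℤ} (h1 : 1 ≤ i)
    (hi : i ≤ n) : 1 ≤ π i ∧ π i ≤ n := by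
  have h := hπ.1.abs_bounds (i := i) (by omega) (by rw [abs_le]; omega)
  rw [abs_le] at h
  have := hπ.2 i.toNat (by omega) (by omega)
  rw [Int.toNat_of_nonneg (by omega)] at this
  omega

lemma InS.inv {n : ℕ} {π : Equiv.Perm ℤ} (hπ : InS n π) : InS n π⁻¹ := by
  refine ⟨hπ.1.inv, fun i h1 hi => ?_⟩
  have h := hπ.1.inv.abs_bounds (i := (i : ℤ)) (by omega) (by rw [abs_le]; omega)
  rw [abs_le] at h
  by_contra! hneg
  have h3 := hπ.bounds (i := -(π⁻¹ (i : ℤ))) (by omega) (by omega)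
  rw [hπ.1.1, ← Equiv.Perm.inv_eq_iff_eq.1 rfl] at h3
  omega

lemma mem_DesA {n b : ℕ} {w : Equiv.Perm ℤ} :
    b ∈ DesA n w ↔ 1 ≤ b ∧ b < n ∧ w ((b : ℤ) + 1) < w b := by
  rw [DesA, Finset.mem_filter, Finset.mem_Ico, and_assoc]
  refine and_congr_right fun h => ?_
  simp [went, show b ≠ 0 by omega]

lemma firstValley_eq_or_mem (n : ℕ) (π : Equiv.Perm ℤ) :
    firstValley n π = n ∨ firstValley n π ∈ (DesA n π⁻¹).erase 1 := by
  unfold firstValley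
  split_ifs with h
  · exact Or.inr (Finset.min'_mem _ _)
  · exact Or.inl rfl

lemma firstValley_le_of_mem {n b : ℕ} {π : Equiv.Perm ℤ} (hb : b ∈ (DesA n π⁻¹).erase 1) :
    firstValley n π ≤ b := by
  rw [firstValley, dif_pos ⟨b, hb⟩]
  exact Finset.min'_le _ _ hb

lemma firstValley_le (n : ℕ) (π : Equiv.Perm ℤ) : firstValley n π ≤ n := by
  rcases firstValley_eq_or_mem n π with h | h
  · exact h.le
  · exact (mem_DesA.1 (Finset.mem_of_mem_erase h)).2.1.le

/-- An integer function increasing at each step of an interval is strictly increasing there. -/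
lemma lt_of_step_lt {f : ℤ → ℤ} {l r : ℤ} (h : ∀ b, l ≤ b → b < r → f b < f (b + 1))
    {a b : ℤ} (ha : l ≤ a) (hab : a < b) (hb : b ≤ r) : f a < f b := by
  induction b, hab using Int.leInduction with
  | base => exact h a ha (by omega)
  | succ m hm ih => exact (ih (by omega)).trans (h m (by omega) (by omega))

/-- The positions of the values `2, …, v(π)` are increasing. -/
lemma inv_lt_inv_of_le_firstValley {n : ℕ} {π : Equiv.Perm ℤ} {a b : ℤ}
    (ha : 1 ≤ a) (ha' : 1 ∉ DesA n π⁻¹ ∨ 2 ≤ a) (hab : a < b) (hb : b ≤ firstValley n π) :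
    π⁻¹ a < π⁻¹ b := by
  refine lt_of_step_lt (l := a) (r := firstValley n π) (fun c hac hcv => ?_) le_rfl hab hb
  have hvn := firstValley_le n π
  lift c to ℕ using by omega
  by_contra! hle
  have hne : π⁻¹ ((c : ℤ) + 1) ≠ π⁻¹ c := fun h => by simpa using π⁻¹.injective h
  have hc : c ∈ DesA n π⁻¹ := mem_DesA.2 ⟨by omega, by omega, lt_of_le_of_ne hle hne⟩
  by_cases h1 : c = 1
  · subst h1
    rcases ha' with h | h
    · exact h hc
    · omega
  · have := firstValley_le_of_mem (Finset.mem_erase.2 ⟨h1, hc⟩)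
    omega

lemma sub_le_of_increasing {n : ℕ} {f : ℤ → ℤ}
    (hf : ∀ i j : ℤ, 1 ≤ i → i < j → j ≤ n → f i < f j) {a b : ℤ} (ha : 1 ≤ a) (hab : a ≤ b)
    (hb : b ≤ n) : b - a ≤ f b - f a := by
  induction b, hab using Int.leInduction with
  | base => simp
  | succ m hm ih =>
    have := ih (by omega)
    have := hf m (m + 1) (by omega) (by omega) hb
    omega

lemma InB.apply_le_of_increasing {n : ℕ} {μ : Equiv.Perm ℤ} (hμ : InB n μ)
    (hinc : ∀ i j : ℤ, 1 ≤ i → i < j → j ≤ n → μ i < μ j) {b : ℤ} (h1 : 1 ≤ b) (hb : b ≤ n) :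
    μ b ≤ b := by
  have h := sub_le_of_increasing hinc h1 hb le_rfl
  have h2 := (hμ.abs_bounds (i := (n : ℤ)) (by omega) (by simp)).2
  rw [abs_le] at h2
  omega

/-- An increasing signed permutation fixes all values beyond its negated ones. -/
lemma InB.apply_eq_self_of_increasing {n : ℕ} {μ : Equiv.Perm ℤ} (hμ : InB n μ)
    (hinc : ∀ i j : ℤ, 1 ≤ i → i < j → j ≤ n → μ i < μ j) {v : ℤ} (hv : 1 ≤ v)
    (hneg : ∀ d : ℤ, 1 ≤ d → d ≤ n → -v ≤ μ d) (c : ℤ) (hvc : v < c) (hcn : c ≤ n) :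
    μ c = c := by
  have hμd : μ (μ⁻¹ c) = c := μ.apply_symm_apply c
  have hb := hμ.inv.abs_bounds (i := c) (by omega) (by rw [abs_le]; omega)
  rw [abs_le] at hb
  generalize μ⁻¹ c = d at hμd hb
  have hdn : d ≤ n := hb.2.2
  have hdpos : 1 ≤ d := by
    by_contra! h
    have h2 := hneg (-d) (by omega) (by omega)
    rw [hμ.1, hμd] at h2
    omega
  have hle := hμ.apply_le_of_increasing hinc hdpos hdn
  rcases (show c ≤ d by omega).eq_or_lt with h | h
  · rw [← h] at hμd; exact hμd
  · have := hμ.apply_eq_self_of_increasing hinc hv hneg d (by omega) hdn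
    omega
termination_by (n - c).toNat
decreasing_by omega

/-- 321-avoidance, in terms of the positions of the values. -/
lemma Avoids321.inv_not {n : ℕ} {π : Equiv.Perm ℤ} (hπ : InS n π) (h : Avoids321 n π)
    {a b c : ℤ} (ha : 1 ≤ a) (hab : a < b) (hbc : b < c) (hc : c ≤ n)
    (h1 : π⁻¹ c < π⁻¹ b) (h2 : π⁻¹ b < π⁻¹ a) : False := by
  have ba := hπ.inv.bounds (i := a) ha (by omega)
  have bb := hπ.inv.bounds (i := b) (by omega) (by omega)
  have bc := hπ.inv.bounds (i := c) (by omega) hc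
  refine h ⟨(π⁻¹ c).toNat, (π⁻¹ b).toNat, (π⁻¹ a).toNat, by omega, by omega, by omega, by omega,
    ?_⟩
  rw [Int.toNat_of_nonneg (by omega), Int.toNat_of_nonneg (by omega),
    Int.toNat_of_nonneg (by omega)]
  simpa using ⟨hab, hbc⟩

section Factorization

variable {n : ℕ} {w μ π : Equiv.Perm ℤ}

/-- Full commutativity of `w = μ ∘ π`, in terms of `μ` and the positions `π⁻¹` of the values
of `π`. -/
lemma isFC_iff_of_factorization (hw : InB n w) (hπ : InS n π)
    (hfact : ∀ i : ℕ, 1 ≤ i → i ≤ n → w i = μ (π i)) :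
    IsFC n w ↔
      (∀ x y : ℤ, 1 ≤ x → x ≤ n → 1 ≤ y → y ≤ n → π⁻¹ x < π⁻¹ y → μ y < μ x → 0 ≤ μ x) ∧
      (∀ x y z : ℤ, 1 ≤ x → x ≤ n → 1 ≤ y → y ≤ n → 1 ≤ z → z ≤ n → π⁻¹ x < π⁻¹ y →
        π⁻¹ y < π⁻¹ z → μ y < |μ x| → μ y ≤ μ z) ∧
      (∀ x y z : ℤ, 1 ≤ x → x ≤ n → 1 ≤ y → y ≤ n → 1 ≤ z → z ≤ n → π⁻¹ x < π⁻¹ y →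
        π⁻¹ y < π⁻¹ z → |μ x| < -μ y → |μ x| ≤ μ z) := by
  have key : ∀ x : ℤ, 1 ≤ x → x ≤ n → ∃ i : ℕ, 1 ≤ i ∧ i ≤ n ∧ π⁻¹ x = i ∧ w i = μ x := by
    intro x h1 hx
    obtain ⟨h, h'⟩ := hπ.inv.bounds h1 hx
    lift π⁻¹ x to ℕ using (by omega) with i hi
    refine ⟨i, by omega, by omega, rfl, ?_⟩
    rw [hfact i (by omega) (by omega), hi]
    simp
  have bd : ∀ i : ℕ, 1 ≤ i → i ≤ n → 1 ≤ π i ∧ π i ≤ n := fun i h1 hi =>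
    hπ.bounds (by omega) (by omega)
  constructor
  · rintro ⟨-, h1, h2, h3⟩
    refine ⟨?_, ?_, ?_⟩
    · intro x y hx hx' hy hy' hxy hμ
      by_contra! hneg
      obtain ⟨i, hi, hi', ei, wi⟩ := key x hx hx'
      obtain ⟨j, hj, hj', ej, wj⟩ := key y hy hy'
      exact h1 ⟨i, j, hi, by omega, hj', by omega, by omega⟩
    · intro x y z hx hx' hy hy' hz hz' hxy hyz hμ
      by_contra! hneg
      obtain ⟨i, hi, hi', ei, wi⟩ := key x hx hx'
      obtain ⟨j, hj, hj', ej, wj⟩ := key y hy hy'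
      obtain ⟨k, hk, hk', ek, wk⟩ := key z hz hz'
      refine h2 ⟨i, j, k, hi, by omega, by omega, hk', ?_⟩
      rw [wi, wj, wk]
      exact ⟨hμ, hneg⟩
    · intro x y z hx hx' hy hy' hz hz' hxy hyz hμ
      by_contra! hneg
      obtain ⟨i, hi, hi', ei, wi⟩ := key x hx hx'
      obtain ⟨j, hj, hj', ej, wj⟩ := key y hy hy'
      obtain ⟨k, hk, hk', ek, wk⟩ := key z hz hz'
      refine h3 ⟨i, j, k, hi, by omega, by omega, hk', ?_⟩
      rw [wi, wj, wk]
      exact ⟨hμ, hneg⟩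
  · rintro ⟨h1, h2, h3⟩
    refine ⟨hw, ?_, ?_, ?_⟩
    · rintro ⟨i, j, hi, hij, hj, hlt, hneg⟩
      obtain ⟨bi, bi'⟩ := bd i hi (by omega)
      obtain ⟨bj, bj'⟩ := bd j (by omega) hj
      rw [hfact i hi (by omega)] at hlt hneg
      rw [hfact j (by omega) hj] at hlt
      exact (h1 _ _ bi bi' bj bj' (by simpa using hij) hlt).not_gt hneg
    all_goals
      rintro ⟨i, j, k, hi, hij, hjk, hk, hlt, hlt'⟩
      obtain ⟨bi, bi'⟩ := bd i hi (by omega)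
      obtain ⟨bj, bj'⟩ := bd j (by omega) (by omega)
      obtain ⟨bk, bk'⟩ := bd k (by omega) hk
      rw [hfact i hi (by omega), hfact j (by omega) (by omega)] at hlt
    · rw [hfact k (by omega) hk, hfact j (by omega) (by omega)] at hlt'
      exact (h2 _ _ _ bi bi' bj bj' bk bk' (by simpa using hij) (by simpa using hjk)
        hlt).not_gt hlt'
    · rw [hfact k (by omega) hk, hfact i (by omega) (by omega)] at hlt'
      exact (h3 _ _ _ bi bi' bj bj' bk bk' (by simpa using hij) (by simpa using hjk)
        hlt).not_gt hlt'

/-- The standardization of a fully commutative signed permutation is 321-avoiding. -/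
lemma IsFC.avoids321 (hw : IsFC n w) (hπ : InS n π)
    (hinc : ∀ i j : ℤ, 1 ≤ i → i < j → j ≤ n → μ i < μ j)
    (hfact : ∀ i : ℕ, 1 ≤ i → i ≤ n → w i = μ (π i)) : Avoids321 n π := by
  rintro ⟨i, j, k, hi, hij, hjk, hk, h1, h2⟩
  have bi := hπ.bounds (i := i) (by omega) (by omega)
  have bj := hπ.bounds (i := j) (by omega) (by omega)
  have bk := hπ.bounds (i := k) (by omega) (by omega)
  refine hw.2.2.1 ⟨i, j, k, hi, hij, hjk, hk, lt_of_lt_of_le ?_ (le_abs_self _), ?_⟩ <;>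
  rw [hfact _ (by omega) (by omega), hfact _ (by omega) (by omega)]
  · exact hinc _ _ bj.1 h2 bi.2
  · exact hinc _ _ bk.1 h1 bj.2

/-- In a fully commutative signed permutation, the absolute values of negative entries are
at most the first valley of the standardization. -/
lemma IsFC.neg_firstValley_le (hw : IsFC n w) (hμ : InB n μ) (hπ : InS n π)
    (hinc : ∀ i j : ℤ, 1 ≤ i → i < j → j ≤ n → μ i < μ j)
    (hfact : ∀ i : ℕ, 1 ≤ i → i ≤ n → w i = μ (π i)) (hn : 0 < n) :
    -(firstValley n π : ℤ) ≤ μ 1 := by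
  have h321 := hw.avoids321 hπ hinc hfact
  obtain ⟨c1, c2, c3⟩ := (isFC_iff_of_factorization hw.1 hπ hfact).1 hw
  by_contra! hlt
  have b1 := (hμ.abs_bounds (i := 1) (by omega) (by rw [abs_le]; omega)).2
  rw [abs_le] at b1
  set v := firstValley n π with hv
  rcases firstValley_eq_or_mem n π with h | h
  · omega
  rw [Finset.mem_erase, mem_DesA, ← hv] at h
  obtain ⟨hv1, hv2, hvn, hdes⟩ := h
  have hμlt : μ ((v : ℤ) + 1) < -μ 1 := by
    have h1 := hμ.apply_le_of_increasing hinc (b := (v : ℤ) + 1) (by omega) (by omega)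
    have h2 : μ ((v : ℤ) + 1) ≠ -μ 1 := fun h => by
      rw [← hμ.1] at h
      have := μ.injective h
      omega
    omega
  have hμv := hinc v (v + 1) (by omega) (by omega) (by omega)
  have hne : π⁻¹ 1 ≠ π⁻¹ ((v : ℤ) + 1) := fun h => by
    have := π⁻¹.injective h
    omega
  have hne' : π⁻¹ 1 ≠ π⁻¹ (v : ℤ) := fun h => by
    have := π⁻¹.injective h
    omega
  have hpos : 0 ≤ μ ((v : ℤ) + 1) :=
    c1 (v + 1) v (by omega) (by omega) (by omega) (by omega) hdes hμv
  rcases lt_or_gt_of_ne hne with h | h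
  · have := c2 1 (v + 1) v le_rfl (by omega) (by omega) (by omega) (by omega) (by omega) h hdes
      (hμlt.trans_le (neg_le_abs _))
    omega
  rcases lt_or_gt_of_ne hne' with h' | h'
  · have := c3 (v + 1) 1 v (by omega) (by omega) (by omega) (by omega) (by omega) (by omega) h h'
    rw [abs_of_nonneg hpos] at this
    have := this hμlt
    omega
  · exact h321.inv_not hπ le_rfl (b := v) (c := v + 1) (by omega) (by omega) (by omega) hdes h'

/-- If `1` is a descent of `π⁻¹`, a fully commutative `w` has at most one negative entry. -/
lemma IsFC.nonneg_of_mem_DesA (hw : IsFC n w) (hπ : InS n π)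
    (hinc : ∀ i j : ℤ, 1 ≤ i → i < j → j ≤ n → μ i < μ j)
    (hfact : ∀ i : ℕ, 1 ≤ i → i ≤ n → w i = μ (π i)) (h1 : 1 ∈ DesA n π⁻¹) : 0 ≤ μ 2 := by
  obtain ⟨-, hn, hdes⟩ := mem_DesA.1 h1
  exact ((isFC_iff_of_factorization hw.1 hπ hfact).1 hw).1 2 1 (by omega) (by omega) (by omega)
    (by omega) (by simpa using hdes) (hinc 1 2 (by omega) (by omega) (by omega))

lemma isFC_of_avoids321 (hw : InB n w) (hμ : InB n μ) (hπ : InS n π)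
    (hinc : ∀ i j : ℤ, 1 ≤ i → i < j → j ≤ n → μ i < μ j)
    (hfact : ∀ i : ℕ, 1 ≤ i → i ≤ n → w i = μ (π i)) (hn : 0 < n) (h321 : Avoids321 n π)
    (hv : -(firstValley n π : ℤ) ≤ μ 1) (h1 : 1 ∉ DesA n π⁻¹ ∨ ∀ x : ℤ, 2 ≤ x → x ≤ n → 0 ≤ μ x) :
    IsFC n w := by
  set v := firstValley n π with hv_def
  have hvn : v ≤ n := firstValley_le n π
  have hv1 : 1 ≤ v := by
    rcases firstValley_eq_or_mem n π with h | h
    · omega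
    · exact (mem_DesA.1 (Finset.mem_of_mem_erase h)).1
  have hμv : ∀ x : ℤ, 1 ≤ x → x ≤ n → -v ≤ μ x - (x - 1) := fun x hx hx' => by
    have := sub_le_of_increasing hinc le_rfl hx hx'
    omega
  have hbig : ∀ x : ℤ, x ≤ n → μ x < v → x ≤ v := fun x hx hlt => by
    by_contra! h
    have := hμ.apply_eq_self_of_increasing hinc (v := v) (by omega)
      (fun d hd hd' => by have := hμv d hd hd'; omega) x h hx
    omega
  have hlt_of : ∀ x y : ℤ, 1 ≤ x → x ≤ n → 1 ≤ y → y ≤ n → μ x < μ y → x < y := by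
    intro x y hx hx' hy hy' hxy
    by_contra! h
    rcases h.eq_or_lt with rfl | h
    · exact hxy.false
    · have := hinc y x hy h hx'
      omega
  have hdesc : ∀ x y : ℤ, 1 ≤ x → x ≤ n → 1 ≤ y → y ≤ n → π⁻¹ x < π⁻¹ y → μ y < μ x → x ≤ v →
      1 ∈ DesA n π⁻¹ ∧ y = 1 := by
    intro x y hx hx' hy hy' hxy hμxy hxv
    have hyx := hlt_of y x hy hy' hx hx' hμxy
    by_contra! h
    have := inv_lt_inv_of_le_firstValley (π := π) hy
      (by by_cases h' : 1 ∈ DesA n π⁻¹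
          · have := h h'
            right; omega
          · exact Or.inl h') hyx hxv
    omega
  have c1 : ∀ x y : ℤ, 1 ≤ x → x ≤ n → 1 ≤ y → y ≤ n → π⁻¹ x < π⁻¹ y → μ y < μ x →
      0 ≤ μ x := by
    intro x y hx hx' hy hy' hxy hμxy
    by_contra! hneg
    have hyx := hlt_of y x hy hy' hx hx' hμxy
    obtain ⟨hd, -⟩ := hdesc x y hx hx' hy hy' hxy hμxy (hbig x hx' (by omega))
    have := (h1.resolve_left (not_not.2 hd)) x (by omega) hx'
    omega
  refine (isFC_iff_of_factorization hw hπ hfact).2 ⟨c1, ?_, ?_⟩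
  · intro x y z hx hx' hy hy' hz hz' hxy hyz hμxy
    by_contra! hlt
    have hzy := hlt_of z y hz hz' hy hy' hlt
    rcases le_or_gt 0 (μ x) with h0 | h0
    · rw [abs_of_nonneg h0] at hμxy
      exact h321.inv_not hπ hz hzy (hlt_of y x hy hy' hx hx' hμxy) hx' hxy hyz
    · rw [abs_of_neg h0] at hμxy
      have := hμv x hx hx'
      obtain ⟨hd, rfl⟩ := hdesc y z hy hy' hz hz' hyz hlt (hbig y hy' (by omega))
      have hx1 : x = 1 := by
        by_contra! hne
        have := (h1.resolve_left (not_not.2 hd)) x (by omega) hx'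
        omega
      subst hx1
      omega
  · intro x y z hx hx' hy hy' hz hz' hxy hyz hμxy
    by_contra! hlt
    have hyneg : μ y < 0 := by have := abs_nonneg (μ x); omega
    rcases le_or_gt 0 (μ x) with h0 | h0
    · rw [abs_of_nonneg h0] at hμxy hlt
      have := hμv y hy hy'
      obtain ⟨hd, rfl⟩ := hdesc x z hx hx' hz hz' (hxy.trans hyz) hlt (hbig x hx' (by omega))
      have hy1 : y = 1 := by
        by_contra! hne
        have := (h1.resolve_left (not_not.2 hd)) y (by omega) hy'
        omega
      subst hy1
      omega
    · rw [abs_of_neg h0] at hμxy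
      have := c1 x y hx hx' hy hy' hxy (by omega)
      omega

end Factorization

theorem fiber_decomposition_FC_Bn (n : ℕ) (hn : 0 < n) (w μ π : Equiv.Perm ℤ)
    (hw : InB n w) (hμ : InB n μ)
    (hμinc : ∀ i j : ℕ, 1 ≤ i → i < j → j ≤ n → μ (i : ℤ) < μ (j : ℤ))
    (hπ : InS n π)
    (hfact : ∀ i : ℕ, 1 ≤ i → i ≤ n → w (i : ℤ) = μ (π (i : ℤ)))
    (N : Finset ℕ)
    (hN : N = (Finset.Icc 1 n).filter
      fun j : ℕ => ∃ i ∈ Finset.Icc 1 n, w ((i : ℕ) : ℤ) = -((j : ℕ) : ℤ)) :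
    IsFC n w ↔ Avoids321 n π ∧
      ((1 ∉ DesA n π⁻¹ ∧ N ⊆ Finset.Icc 1 (firstValley n π)) ∨
       (1 ∈ DesA n π⁻¹ ∧ N.card ≤ 1 ∧ N ⊆ Finset.Icc 1 (firstValley n π))) := by
  have hinc : ∀ i j : ℤ, 1 ≤ i → i < j → j ≤ n → μ i < μ j := fun i j hi hij hj => by
    lift i to ℕ using by omega
    lift j to ℕ using by omega
    exact hμinc i j (by omega) (by omega) (by omega)
  have hle : ∀ x : ℤ, 1 ≤ x → x ≤ n → μ 1 ≤ μ x := fun x hx hx' => by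
    have := sub_le_of_increasing hinc le_rfl hx hx'
    omega
  have hmem : ∀ j : ℕ, j ∈ N ↔ 1 ≤ j ∧ ∃ x : ℤ, 1 ≤ x ∧ x ≤ n ∧ μ x = -j := by
    intro j
    rw [hN, @Finset.mem_filter _ _ (fun _ => Classical.propDecidable _), Finset.mem_Icc]
    constructor
    · rintro ⟨hj, i, hi, hwi⟩
      rw [Finset.mem_Icc] at hi
      rw [hfact i hi.1 hi.2] at hwi
      have := hπ.bounds (i := i) (by omega) (by omega)
      exact ⟨hj.1, _, this.1, this.2, hwi⟩
    · rintro ⟨hj, x, hx, hx', hμx⟩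
      have hb := (hμ.abs_bounds (i := x) (by omega) (by rw [abs_le]; omega)).2
      rw [hμx, abs_le] at hb
      obtain ⟨h, h'⟩ := hπ.inv.bounds hx hx'
      lift π⁻¹ x to ℕ using (by omega) with i hi
      refine ⟨⟨hj, by omega⟩, i, Finset.mem_Icc.2 ⟨by omega, by omega⟩, ?_⟩
      rw [hfact i (by omega) (by omega), hi]
      simpa using hμx
  have hsub : N ⊆ Finset.Icc 1 (firstValley n π) ↔ -(firstValley n π : ℤ) ≤ μ 1 := by
    constructor
    · intro h
      by_contra! hlt
      have := Finset.mem_Icc.1 (h ((hmem (-μ 1).toNat).2 ⟨by omega, 1, by omega, by omega,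
        by omega⟩))
      omega
    · intro h j hj
      obtain ⟨hj1, x, hx, hx', hμx⟩ := (hmem j).1 hj
      have := hle x hx hx'
      exact Finset.mem_Icc.2 ⟨hj1, by omega⟩
  constructor
  · intro hFC
    have hN' := hsub.2 (hFC.neg_firstValley_le hμ hπ hinc hfact hn)
    refine ⟨hFC.avoids321 hπ hinc hfact, ?_⟩
    by_cases h1 : 1 ∈ DesA n π⁻¹
    · refine Or.inr ⟨h1, ?_, hN'⟩
      have h2 := hFC.nonneg_of_mem_DesA hπ hinc hfact h1
      have hone : ∀ j ∈ N, μ 1 = -j := fun j hj => by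
        obtain ⟨hj1, x, hx, hx', hμx⟩ := (hmem j).1 hj
        by_cases hx1 : x = 1
        · rw [← hx1, hμx]
        · have := sub_le_of_increasing hinc (a := 2) (by omega) (b := x) (by omega) hx'
          omega
      refine Finset.card_le_one.2 fun a ha b hb => ?_
      have := hone a ha
      have := hone b hb
      omega
    · exact Or.inl ⟨h1, hN'⟩
  · rintro ⟨h321, ⟨h1, hN'⟩ | ⟨-, hcard, hN'⟩⟩
    · exact isFC_of_avoids321 hw hμ hπ hinc hfact hn h321 (hsub.1 hN') (Or.inl h1)
    · refine isFC_of_avoids321 hw hμ hπ hinc hfact hn h321 (hsub.1 hN')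
        (Or.inr fun x hx hx' => ?_)
      by_contra! hneg
      have hlt := hinc 1 x le_rfl (by omega) hx'
      have := Finset.card_le_one.1 hcard (-μ 1).toNat
        ((hmem _).2 ⟨by omega, 1, by omega, by omega, by omega⟩) (-μ x).toNat
        ((hmem _).2 ⟨by omega, x, by omega, by omega, by omega⟩)
      omega

end Paper
end
end

section
/- Let n be a positive integer. A signed permutation w∈B_n is fully commutative if and only if the RSK shape λ(w^0) of the sequence w^0:=[−w_n,−w_{n−1},…,−w_1,w_1,…,w_n] equals (2n−k,k) for some 0≤k≤n or (2n−2k,2k−1,1) for some 1≤k≤⌊n/2⌋. Consequently, FC(B_n) is a disjoint union of the two-sided combinatorial (Barbash–Vogan) cells of these admissible shapes. -/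
open scoped Classical

noncomputable section

namespace Paper

/-- The set `{-n,…,-1,1,…,n}` of positions of `w^0`. -/
def positions (n : ℕ) : Finset ℤ := (Finset.Icc (-(n : ℤ)) n).erase 0

lemma mem_positions {n : ℕ} {x : ℤ} : x ∈ positions n ↔ x ≠ 0 ∧ -(n : ℤ) ≤ x ∧ x ≤ n := by
  simp [positions]

lemma card_positions (n : ℕ) : (positions n).card = 2 * n := by
  rw [positions, Finset.card_erase_of_mem (by simp), Int.card_Icc]
  omega

/-- `P` is a union of `j` subsequences along which `w` increases. -/
def Colored (w : ℤ → ℤ) (P : Finset ℤ) (j : ℕ) : Prop :=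
  ∃ c : ℤ → Fin j, ∀ p ∈ P, ∀ q ∈ P, p < q → c p = c q → w p < w q

/-- The order isomorphism from `{1,…,2n}` to the signed positions. -/
def signedPos (n : ℕ) (p : ℕ) : ℤ := if p ≤ n then (p : ℤ) - n - 1 else (p : ℤ) - n

/-- The inverse of `signedPos`. -/
def unsignedPos (n : ℕ) (x : ℤ) : ℕ := if x < 0 then (x + n + 1).toNat else (x + n).toNat

lemma signedPos_lt {n p q : ℕ} (h : p < q) : signedPos n p < signedPos n q := by
  unfold signedPos
  split_ifs <;> omega

lemma signedPos_injective (n : ℕ) : Function.Injective (signedPos n) :=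
  StrictMono.injective fun _ _ => signedPos_lt

lemma signedPos_mem {n p : ℕ} (h : p ∈ Finset.Icc 1 (2 * n)) : signedPos n p ∈ positions n := by
  rw [Finset.mem_Icc] at h
  rw [mem_positions]
  unfold signedPos
  split_ifs <;> omega

lemma unsignedPos_mem {n : ℕ} {x : ℤ} (h : x ∈ positions n) :
    unsignedPos n x ∈ Finset.Icc 1 (2 * n) := by
  rw [mem_positions] at h
  rw [Finset.mem_Icc]
  unfold unsignedPos
  split_ifs <;> omega

lemma signedPos_unsignedPos {n : ℕ} {x : ℤ} (h : x ∈ positions n) :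
    signedPos n (unsignedPos n x) = x := by
  rw [mem_positions] at h
  unfold signedPos unsignedPos
  split_ifs <;> omega

lemma unsignedPos_signedPos {n p : ℕ} (h : p ∈ Finset.Icc 1 (2 * n)) :
    unsignedPos n (signedPos n p) = p := by
  rw [Finset.mem_Icc] at h
  unfold signedPos unsignedPos
  split_ifs <;> omega

lemma wzero_eq {n : ℕ} {w : Equiv.Perm ℤ} (hw : ∀ i, w (-i) = -w i) (p : ℕ) :
    wzero n w p = w (signedPos n p) := by
  unfold wzero signedPos
  split_ifs
  · rw [← hw]
    congr 1
    ring
  · rfl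

lemma Colored.card_le_greene {n j : ℕ} {w : Equiv.Perm ℤ} (hw : ∀ i, w (-i) = -w i)
    {P : Finset ℤ} (hP : P ⊆ positions n) (h : Colored w P j) : P.card ≤ greene n w j := by
  obtain ⟨c, hc⟩ := h
  have hinj : Set.InjOn (unsignedPos n) P := fun x hx y hy hxy => by
    rw [← signedPos_unsignedPos (hP hx), hxy, signedPos_unsignedPos (hP hy)]
  rw [← Finset.card_image_of_injOn hinj]
  refine Finset.le_sup (f := Finset.card) (Finset.mem_filter.2 ⟨?_, fun p => c (signedPos n p), ?_⟩)
  · rw [Finset.mem_powerset]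
    exact Finset.image_subset_iff.2 fun x hx => unsignedPos_mem (hP hx)
  · simp only [Finset.forall_mem_image]
    intro x hx y hy hxy hcol
    have hlt := signedPos_lt (n := n) hxy
    rw [wzero_eq hw, wzero_eq hw]
    rw [signedPos_unsignedPos (hP hx), signedPos_unsignedPos (hP hy)] at *
    exact hc x hx y hy hlt hcol

lemma exists_colored_card_eq_greene {n j : ℕ} (hj : 0 < j) {w : Equiv.Perm ℤ}
    (hw : ∀ i, w (-i) = -w i) :
    ∃ P ⊆ positions n, Colored w P j ∧ P.card = greene n w j := by
  obtain ⟨Q, hQ, hcard⟩ := Finset.exists_mem_eq_sup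
    ((Finset.Icc 1 (2 * n)).powerset.filter fun P =>
      ∃ c : ℕ → Fin j, ∀ p ∈ P, ∀ q ∈ P, p < q → c p = c q → wzero n w p < wzero n w q)
    ⟨∅, Finset.mem_filter.2 ⟨by simp, fun _ => ⟨0, hj⟩, by simp⟩⟩ Finset.card
  obtain ⟨hsub, c, hc⟩ := Finset.mem_filter.1 hQ
  rw [Finset.mem_powerset] at hsub
  refine ⟨Q.image (signedPos n), Finset.image_subset_iff.2 fun p hp => signedPos_mem (hsub hp),
    ⟨fun x => c (unsignedPos n x), ?_⟩, ?_⟩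
  · simp only [Finset.forall_mem_image]
    intro p hp q hq hpq hcol
    rw [unsignedPos_signedPos (hsub hp), unsignedPos_signedPos (hsub hq)] at hcol
    rw [← wzero_eq hw, ← wzero_eq hw]
    refine hc p hp q hq ?_ hcol
    by_contra! hle
    rcases hle.lt_or_eq with hlt | rfl
    · exact absurd (signedPos_lt (n := n) hlt) hpq.not_gt
    · exact absurd hpq (lt_irrefl _)
  · rw [Finset.card_image_of_injective _ (signedPos_injective n)]
    exact hcard.symm

lemma Colored.not_decreasing_triple {w : ℤ → ℤ} {P : Finset ℤ} (h : Colored w P 2) {x y z : ℤ}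
    (hx : x ∈ P) (hy : y ∈ P) (hz : z ∈ P) (hxy : x < y) (hyz : y < z)
    (hwxy : w y < w x) (hwyz : w z < w y) : False := by
  obtain ⟨c, hc⟩ := h
  have h1 : c x ≠ c y := fun e => absurd (hc x hx y hy hxy e) (by omega)
  have h2 : c y ≠ c z := fun e => absurd (hc y hy z hz hyz e) (by omega)
  have h3 : c x ≠ c z := fun e => absurd (hc x hx z hz (hxy.trans hyz) e) (by omega)
  omega

lemma colored_two_of_avoids {w : ℤ → ℤ} (hw : Function.Injective w) {P : Finset ℤ}
    (h : ∀ x ∈ P, ∀ y ∈ P, ∀ z ∈ P, x < y → y < z → w y < w x → w z < w y → False) :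
    Colored w P 2 := by
  refine ⟨fun p => if ∃ q ∈ P, p < q ∧ w q < w p then 0 else 1, fun p hp q hq hpq hcol => ?_⟩
  by_contra! hle
  have hlt : w q < w p := lt_of_le_of_ne hle fun e => hpq.ne' (hw e)
  have hex : ∃ q ∈ P, p < q ∧ w q < w p := ⟨q, hq, hpq, hlt⟩
  by_cases hq' : ∃ r ∈ P, q < r ∧ w r < w q
  · obtain ⟨r, hr, hqr, hwr⟩ := hq'
    exact h p hp q hq r hr hpq hqr hlt hwr
  · simp [hex, hq'] at hcol

lemma Colored.card_le_two_mul_greene_one {n : ℕ} {w : Equiv.Perm ℤ} (hw : ∀ i, w (-i) = -w i)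
    {P : Finset ℤ} (hP : P ⊆ positions n) (h : Colored w P 2) :
    P.card ≤ 2 * greene n w 1 := by
  obtain ⟨c, hc⟩ := h
  have hone (d : Fin 2) : (P.filter fun p => c p = d).card ≤ greene n w 1 := by
    refine Colored.card_le_greene hw ((Finset.filter_subset _ _).trans hP)
      ⟨fun _ => 0, fun p hp q hq hpq _ => ?_⟩
    rw [Finset.mem_filter] at hp hq
    exact hc p hp.1 q hq.1 hpq (hp.2.trans hq.2.symm)
  have hsplit := Finset.card_filter_add_card_filter_not (s := P) (fun p => c p = 0)
  have hne : (P.filter fun p => ¬ c p = 0) = P.filter fun p => c p = 1 :=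
    Finset.filter_congr fun p _ => by omega
  rw [hne] at hsplit
  have h0 := hone 0
  have h1 := hone 1
  omega

lemma Colored.insert {w : ℤ → ℤ} {P : Finset ℤ} {j : ℕ} (h : Colored w P j) (e : ℤ) :
    Colored w (insert e P) (j + 1) := by
  obtain ⟨c, hc⟩ := h
  refine ⟨fun p => if p = e then Fin.last j else (c p).castSucc, fun p hp q hq hpq hcol => ?_⟩
  rw [Finset.mem_insert] at hp hq
  by_cases hpe : p = e <;> by_cases hqe : q = e
  · omega
  · simp only [hpe, hqe, if_true, if_false] at hcol
    exact absurd hcol.symm (Fin.castSucc_lt_last _).ne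
  · simp only [hpe, hqe, if_true, if_false] at hcol
    exact absurd hcol (Fin.castSucc_lt_last _).ne
  · simp only [hpe, hqe, if_false, Fin.castSucc_inj] at hcol
    exact hc p (hp.resolve_left hpe) q (hq.resolve_left hqe) hpq hcol

lemma greene_le {n j : ℕ} {w : Equiv.Perm ℤ} : greene n w j ≤ 2 * n := by
  refine Finset.sup_le fun P hP => ?_
  have := Finset.card_le_card (Finset.mem_powerset.1 (Finset.mem_filter.1 hP).1)
  simpa using this

lemma exists_missing {n : ℕ} {P : Finset ℤ} (hP : P ⊆ positions n) (hcard : 2 * n ≤ P.card + 1) :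
    ∃ e, ∀ x ∈ positions n, x ≠ e → x ∈ P := by
  have hle : (positions n \ P).card ≤ 1 := by
    rw [Finset.card_sdiff_of_subset hP, card_positions]
    omega
  obtain ⟨e, he⟩ := Finset.card_le_one_iff_subset_singleton.1 hle
  refine ⟨e, fun x hx hxe => ?_⟩
  by_contra hxP
  exact hxe (Finset.mem_singleton.1 (he (Finset.mem_sdiff.2 ⟨hx, hxP⟩)))

lemma isFC_of_greene_two {n : ℕ} {w : Equiv.Perm ℤ} (hw : InB n w)
    (h : 2 * n ≤ greene n w 2 + 1) : IsFC n w := by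
  obtain ⟨P, hP, hcol, hcard⟩ := exists_colored_card_eq_greene (n := n) two_pos hw.1
  obtain ⟨e, he⟩ := exists_missing hP (hcard ▸ h)
  have hneg := hw.1
  have key (x y z : ℤ) (hx : x ≠ 0) (hxn : -(n : ℤ) ≤ x) (hxy : x < y) (hyz : y < z) (hy : y ≠ 0)
      (hz : z ≠ 0) (hzn : z ≤ n) (h1 : x ≠ -y) (h2 : x ≠ -z) (h3 : y ≠ -z)
      (hwxy : w y < w x) (hwyz : w z < w y) : False := by
    by_cases hmem : x ≠ e ∧ y ≠ e ∧ z ≠ e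
    · exact hcol.not_decreasing_triple (he x (mem_positions.2 (by omega)) hmem.1)
        (he y (mem_positions.2 (by omega)) hmem.2.1) (he z (mem_positions.2 (by omega)) hmem.2.2)
        hxy hyz hwxy hwyz
    · have hx' := hneg x
      have hy' := hneg y
      have hz' := hneg z
      exact hcol.not_decreasing_triple (he (-z) (mem_positions.2 (by omega)) (by omega))
        (he (-y) (mem_positions.2 (by omega)) (by omega))
        (he (-x) (mem_positions.2 (by omega)) (by omega))
        (by omega) (by omega) (by omega) (by omega)
  refine ⟨hw, ?_, ?_, ?_⟩
  · rintro ⟨i, j, hi, hij, hj, h1, h2⟩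
    have hi' := hneg i
    have hj' := hneg j
    by_cases hie : (-i : ℤ) ≠ e ∧ (i : ℤ) ≠ e
    · by_cases hje : (j : ℤ) ≠ e
      · exact hcol.not_decreasing_triple (he (-i) (mem_positions.2 (by omega)) hie.1)
          (he i (mem_positions.2 (by omega)) hie.2) (he j (mem_positions.2 (by omega)) hje)
          (by omega) (by omega) (by omega) (by omega)
      · exact hcol.not_decreasing_triple (he (-j) (mem_positions.2 (by omega)) (by omega))
          (he (-i) (mem_positions.2 (by omega)) hie.1) (he i (mem_positions.2 (by omega)) hie.2)
          (by omega) (by omega) (by omega) (by omega)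
    · by_cases hie' : (-i : ℤ) ≠ e
      · exact hcol.not_decreasing_triple (he (-j) (mem_positions.2 (by omega)) (by omega))
          (he (-i) (mem_positions.2 (by omega)) hie') (he j (mem_positions.2 (by omega)) (by omega))
          (by omega) (by omega) (by omega) (by omega)
      · exact hcol.not_decreasing_triple (he (-j) (mem_positions.2 (by omega)) (by omega))
          (he i (mem_positions.2 (by omega)) (by omega))
          (he j (mem_positions.2 (by omega)) (by omega))
          (by omega) (by omega) (by omega) (by omega)
  · rintro ⟨i, j, k, hi, hij, hjk, hk, h1, h2⟩
    rcases abs_cases (w i) with ⟨ha, _⟩ | ⟨ha, _⟩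
    · exact key i j k (by omega) (by omega) (by omega) (by omega) (by omega) (by omega) (by omega)
        (by omega) (by omega) (by omega) (by omega) h2
    · have hi' := hneg i
      exact key (-i) j k (by omega) (by omega) (by omega) (by omega) (by omega) (by omega)
        (by omega) (by omega) (by omega) (by omega) (by omega) h2
  · rintro ⟨i, j, k, hi, hij, hjk, hk, h1, h2⟩
    have hj' := hneg j
    rcases abs_cases (w i) with ⟨ha, _⟩ | ⟨ha, _⟩
    · exact key (-j) i k (by omega) (by omega) (by omega) (by omega) (by omega) (by omega)
        (by omega) (by omega) (by omega) (by omega) (by omega) (by omega)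
    · have hi' := hneg i
      exact key (-j) (-i) k (by omega) (by omega) (by omega) (by omega) (by omega) (by omega)
        (by omega) (by omega) (by omega) (by omega) (by omega) (by omega)

/-- The three forbidden patterns, with integer indices. -/
lemma IsFC.patterns {n : ℕ} {w : Equiv.Perm ℤ} (h : IsFC n w) :
    (∀ i j : ℤ, 1 ≤ i → i < j → j ≤ n → w j < w i → w i < 0 → False) ∧
    (∀ i j k : ℤ, 1 ≤ i → i < j → j < k → k ≤ n → w j < |w i| → w k < w j → False) ∧
    (∀ i j k : ℤ, 1 ≤ i → i < j → j < k → k ≤ n → |w i| < -w j → w k < |w i| → False) := by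
  obtain ⟨-, h1, h2, h3⟩ := h
  refine ⟨fun i j hi hij hj a b => h1 ⟨i.toNat, j.toNat, ?_⟩,
    fun i j k hi hij hjk hk a b => h2 ⟨i.toNat, j.toNat, k.toNat, ?_⟩,
    fun i j k hi hij hjk hk a b => h3 ⟨i.toNat, j.toNat, k.toNat, ?_⟩⟩
  · rw [Int.toNat_of_nonneg (by omega), Int.toNat_of_nonneg (by omega)]
    exact ⟨by omega, by omega, by omega, a, b⟩
  all_goals
    rw [Int.toNat_of_nonneg (by omega), Int.toNat_of_nonneg (by omega),
      Int.toNat_of_nonneg (by omega)]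
    exact ⟨by omega, by omega, by omega, by omega, a, b⟩

lemma ne_zero_of_odd {w : Equiv.Perm ℤ} (hw : ∀ i, w (-i) = -w i) {x : ℤ} (hx : x ≠ 0) :
    w x ≠ 0 := fun h => hx <| by
  have h0 := hw 0
  rw [neg_zero] at h0
  exact w.injective (by omega)

lemma IsFC.eq_neg_of_decreasing_of_pos {n : ℕ} {w : Equiv.Perm ℤ} (h : IsFC n w) {x y z : ℤ}
    (hx : x ≠ 0) (hxn : -(n : ℤ) ≤ x) (hxy : x < y) (hyz : y < z) (hy : 0 < y) (hzn : z ≤ n)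
    (hwxy : w y < w x) (hwyz : w z < w y) : x = -z := by
  obtain ⟨h1, h2, h3⟩ := h.patterns
  have hneg := h.1.1
  have hx' := hneg x
  have hy0 := ne_zero_of_odd hneg hy.ne'
  rcases hx.lt_or_gt with hx | hx
  · have hwy : 0 < w y := by
      by_contra! hle
      exact h1 y z (by omega) hyz hzn hwyz (by omega)
    have hay : |w y| = w y := abs_of_pos hwy
    have habs : -w (-x) ≤ |w (-x)| := neg_le_abs _
    by_contra hne
    rcases lt_trichotomy (-x) y with hlt | heq | hgt
    · exact h2 (-x) y z (by omega) hlt hyz hzn (by omega) hwyz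
    · rw [heq] at hx'
      omega
    · rcases lt_or_gt_of_ne (show -x ≠ z by omega) with hlt | hlt
      · exact h3 y (-x) z (by omega) hgt hlt hzn (by omega) (by omega)
      · by_cases hz : w y < -w z
        · exact h3 y z (-x) (by omega) hyz hlt (by omega) (by omega) (by omega)
        · exact h2 y z (-x) (by omega) hyz hlt (by omega) (by omega) (by omega)
  · exact (h2 x y z (by omega) hxy hyz hzn (hwxy.trans_le (le_abs_self _)) hwyz).elim

lemma IsFC.eq_neg_of_decreasing {n : ℕ} {w : Equiv.Perm ℤ} (h : IsFC n w) {x y z : ℤ}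
    (hx : x ∈ positions n) (hy : y ∈ positions n) (hz : z ∈ positions n)
    (hxy : x < y) (hyz : y < z) (hwxy : w y < w x) (hwyz : w z < w y) : x = -z := by
  rw [mem_positions] at hx hy hz
  rcases hy.1.lt_or_gt with hy' | hy'
  · have hx' := h.1.1 x
    have hy'' := h.1.1 y
    have hz' := h.1.1 z
    have := h.eq_neg_of_decreasing_of_pos (x := -z) (y := -y) (z := -x) (by omega) (by omega)
      (by omega) (by omega) (by omega) (by omega) (by omega) (by omega)
    omega
  · exact h.eq_neg_of_decreasing_of_pos hx.1 hx.2.1 hxy hyz hy' hz.2.2 hwxy hwyz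

lemma IsFC.pos_of_ne {n : ℕ} {w : Equiv.Perm ℤ} (h : IsFC n w) {i j m : ℤ} (hj : 1 ≤ j)
    (hji : j < i) (hi : i ≤ n) (hwi : |w j| < -w i) (hm : 1 ≤ m) (hmn : m ≤ n) (hmi : m ≠ i) :
    0 < w m := by
  obtain ⟨h1, h2, h3⟩ := h.patterns
  have hj0 := abs_pos.2 (ne_zero_of_odd h.1.1 (show j ≠ 0 by omega))
  have hm0 := ne_zero_of_odd h.1.1 (show m ≠ 0 by omega)
  have hjabs := neg_le_abs (w j)
  have hjabs' := le_abs_self (w j)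
  have hmabs := neg_le_abs (w m)
  have hne : w m ≠ w i := fun e => hmi (w.injective e)
  by_contra! hle
  rcases lt_or_gt_of_ne hmi with hlt | hgt
  · have hwm : w m < w i := by
      by_contra! hle'
      exact h1 m i hm hlt hi (by omega) (by omega)
    rcases lt_trichotomy m j with hmj | rfl | hmj
    · exact h2 m j i hm hmj hji hi (by omega) (by omega)
    · omega
    · exact h3 j m i hj hmj hlt hi (by omega) (by omega)
  · exact h3 j i m hj hji hgt hmn hwi (by omega)

/-- A strictly increasing set of positive positions with positive values can be doubled by
symmetry. -/
lemma two_mul_card_le_greene_one {n : ℕ} {w : Equiv.Perm ℤ} (hw : ∀ i, w (-i) = -w i)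
    {A : Finset ℤ} (hA : A ⊆ positions n) (hpos : ∀ x ∈ A, 0 < x ∧ 0 < w x)
    (hmono : StrictMonoOn w A) : 2 * A.card ≤ greene n w 1 := by
  have hdisj : Disjoint A (A.image fun x => -x) := by
    rw [Finset.disjoint_left]
    intro x hx hx'
    obtain ⟨y, hy, rfl⟩ := Finset.mem_image.1 hx'
    have := hpos y hy
    have := hpos _ hx
    omega
  have hcard : (A ∪ A.image fun x => -x).card = 2 * A.card := by
    rw [Finset.card_union_of_disjoint hdisj, Finset.card_image_of_injective _ neg_injective]
    ring
  rw [← hcard]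
  refine Colored.card_le_greene hw ?_ ⟨fun _ => 0, ?_⟩
  · refine Finset.union_subset hA (Finset.image_subset_iff.2 fun x hx => ?_)
    have := mem_positions.1 (hA hx)
    exact mem_positions.2 (by omega)
  · intro p hp q hq hpq _
    rw [Finset.mem_union, Finset.mem_image] at hp hq
    rcases hp with hp | ⟨p, hp, rfl⟩ <;> rcases hq with hq | ⟨q, hq, rfl⟩
    · exact hmono hp hq hpq
    · have := hpos _ hp
      have := hpos _ hq
      omega
    · have := hpos _ hp
      have := hpos _ hq
      have := hw p
      omega
    · have := hmono hq hp (show q < p by omega)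
      have := hw p
      have := hw q
      omega

lemma two_mul_card_le_greene_one_of_neg {n : ℕ} {w : Equiv.Perm ℤ} (hw : ∀ i, w (-i) = -w i)
    {A : Finset ℤ} (hA : A ⊆ positions n) (hneg : ∀ x ∈ A, x < 0 ∧ w x < 0)
    (hmono : StrictMonoOn w A) : 2 * A.card ≤ greene n w 1 := by
  rw [← Finset.card_image_of_injective A neg_injective]
  refine two_mul_card_le_greene_one hw ?_ ?_ ?_
  · refine Finset.image_subset_iff.2 fun x hx => ?_
    have := mem_positions.1 (hA hx)
    exact mem_positions.2 (by omega)
  · simp only [Finset.forall_mem_image]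
    intro x hx
    have := hneg x hx
    have := hw x
    omega
  · intro a ha b hb hxy
    obtain ⟨x, hx, rfl⟩ := Finset.mem_image.1 ha
    obtain ⟨y, hy, rfl⟩ := Finset.mem_image.1 hb
    have := hmono hy hx (show y < x by omega)
    have := hw x
    have := hw y
    omega

lemma IsFC.even_greene_one_of_mem {n : ℕ} {w : Equiv.Perm ℤ} (h : IsFC n w) {i j : ℤ} (hj : 1 ≤ j)
    (hji : j < i) (hi : i ≤ n) (hwi : |w j| < -w i) {I : Finset ℤ} (hI : I ⊆ positions n)
    (hmono : StrictMonoOn w I) (hcard : I.card = greene n w 1) (hmem : -i ∈ I) :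
    Even (greene n w 1) := by
  have hneg := h.1.1
  have hpos {m : ℤ} (hm : 1 ≤ m) (hmn : m ≤ n) (hmi : m ≠ i) : 0 < w m :=
    h.pos_of_ne hj hji hi hwi hm hmn hmi
  have hwj : 0 < w j := hpos hj (by omega) (by omega)
  rw [abs_of_pos hwj] at hwi
  have hi' := hneg i
  have hA := two_mul_card_le_greene_one_of_neg (n := n) hneg (A := I.filter fun x => x < -i)
    ((Finset.filter_subset _ _).trans hI)
    (fun x hx => by
      rw [Finset.mem_filter] at hx
      have hx' := mem_positions.1 (hI hx.1)
      have := hpos (m := -x) (by omega) (by omega) (by omega)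
      have := hneg x
      omega)
    (hmono.mono fun x hx => (Finset.mem_filter.1 hx).1)
  have hBpos {x : ℤ} (hx : x ∈ I) (hxi : -i < x) : 0 < x ∧ -w i < w x := by
    have hwx : w (-i) < w x := hmono hmem hx hxi
    have hx' := mem_positions.1 (hI hx)
    have := hneg x
    by_contra hcon
    have := hpos (m := -x) (by omega) (by omega) (by omega)
    omega
  have hBgt {x : ℤ} (hx : x ∈ I) (hxi : -i < x) : j < x := by
    have hb := hBpos hx hxi
    rcases lt_trichotomy x j with hlt | rfl | hgt
    · exact (h.patterns.2.1 x j i (by omega) hlt hji hi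
        (lt_of_lt_of_le (by omega) (le_abs_self _)) (by omega)).elim
    · omega
    · exact hgt
  have hjI : j ∉ I.filter fun x => -i < x := fun hjm => by
    rw [Finset.mem_filter] at hjm
    exact lt_irrefl _ (hBgt hjm.1 hjm.2)
  have hB := two_mul_card_le_greene_one (n := n) hneg (A := insert j (I.filter fun x => -i < x))
    (Finset.insert_subset (mem_positions.2 (by omega)) ((Finset.filter_subset _ _).trans hI))
    (fun x hx => by
      rw [Finset.mem_insert, Finset.mem_filter] at hx
      rcases hx with rfl | hx
      · omega
      · have := hBpos hx.1 hx.2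
        omega)
    (fun x hx y hy hxy => by
      rw [Finset.mem_coe, Finset.mem_insert, Finset.mem_filter] at hx hy
      rcases hx with rfl | hx <;> rcases hy with rfl | hy
      · exact absurd hxy (lt_irrefl _)
      · have := hBpos hy.1 hy.2
        omega
      · exact absurd (hBgt hx.1 hx.2) hxy.not_gt
      · exact hmono hx.1 hy.1 hxy)
  rw [Finset.card_insert_of_notMem hjI] at hB
  have hsplit : (I.filter fun x => x < -i).card + (I.filter fun x => -i < x).card + 1 = I.card := by
    rw [← Finset.card_filter_add_card_filter_not (s := I) (fun x => x < -i), add_assoc]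
    congr 1
    have hnot : (-i) ∉ I.filter fun x => -i < x := by simp
    rw [← Finset.card_insert_of_notMem hnot]
    congr 1
    ext x
    simp only [Finset.mem_insert, Finset.mem_filter]
    constructor
    · rintro (rfl | hx)
      · exact ⟨hmem, lt_irrefl _⟩
      · exact ⟨hx.1, hx.2.not_gt⟩
    · rintro ⟨hx, hxi⟩
      rcases eq_or_lt_of_le (not_lt.1 hxi) with heq | hlt
      · exact Or.inl heq.symm
      · exact Or.inr ⟨hx, hlt⟩
  rw [Nat.even_iff]
  omega

lemma IsFC.even_greene_one {n : ℕ} {w : Equiv.Perm ℤ} (h : IsFC n w) {i j : ℤ} (hj : 1 ≤ j)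
    (hji : j < i) (hi : i ≤ n) (hwi : |w j| < -w i) : Even (greene n w 1) := by
  have hneg := h.1.1
  obtain ⟨I, hI, ⟨c, hc⟩, hcard⟩ := exists_colored_card_eq_greene (n := n) one_pos hneg
  have hmono : StrictMonoOn w I := fun x hx y hy hxy => hc x hx y hy hxy (Subsingleton.elim _ _)
  by_cases hmem : -i ∈ I
  · exact h.even_greene_one_of_mem hj hji hi hwi hI hmono hcard hmem
  by_cases hmem' : i ∈ I
  · refine h.even_greene_one_of_mem hj hji hi hwi (I := I.image fun x => -x)
      (Finset.image_subset_iff.2 fun x hx => ?_) ?_ ?_ (Finset.mem_image_of_mem _ hmem')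
    · have := mem_positions.1 (hI hx)
      exact mem_positions.2 (by omega)
    · intro a ha b hb hxy
      obtain ⟨x, hx, rfl⟩ := Finset.mem_image.1 ha
      obtain ⟨y, hy, rfl⟩ := Finset.mem_image.1 hb
      have := hmono hy hx (show y < x by omega)
      have := hneg x
      have := hneg y
      omega
    · rw [Finset.card_image_of_injective _ neg_injective, hcard]
  have hsign {x : ℤ} (hx : x ∈ I) : x < 0 ∧ w x < 0 ∨ 0 < x ∧ 0 < w x := by
    have hx' := mem_positions.1 (hI hx)
    have hxi : x ≠ i := fun e => hmem' (e ▸ hx)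
    have hxi' : x ≠ -i := fun e => hmem (e ▸ hx)
    rcases hx'.1.lt_or_gt with hlt | hgt
    · have := h.pos_of_ne hj hji hi hwi (m := -x) (by omega) (by omega) (by omega)
      have := hneg x
      omega
    · have := h.pos_of_ne hj hji hi hwi (m := x) (by omega) (by omega) (by omega)
      omega
  have hA := two_mul_card_le_greene_one_of_neg (n := n) hneg (A := I.filter fun x => x < 0)
    ((Finset.filter_subset _ _).trans hI)
    (fun x hx => by
      rw [Finset.mem_filter] at hx
      have := hsign hx.1
      omega)
    (hmono.mono fun x hx => (Finset.mem_filter.1 hx).1)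
  have hB := two_mul_card_le_greene_one (n := n) hneg (A := I.filter fun x => ¬ x < 0)
    ((Finset.filter_subset _ _).trans hI)
    (fun x hx => by
      rw [Finset.mem_filter] at hx
      have := hsign hx.1
      omega)
    (hmono.mono fun x hx => (Finset.mem_filter.1 hx).1)
  have hsplit := Finset.card_filter_add_card_filter_not (s := I) (fun x => x < 0)
  rw [Nat.even_iff]
  omega

lemma IsFC.admissible {n : ℕ} {w : Equiv.Perm ℤ} (h : IsFC n w) :
    (∃ k ≤ n, greene n w 1 = 2 * n - k ∧ greene n w 2 = 2 * n) ∨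
      (∃ k, 1 ≤ k ∧ 2 * k ≤ n ∧ greene n w 1 = 2 * n - 2 * k ∧
        greene n w 2 = 2 * n - 1 ∧ greene n w 3 = 2 * n) := by
  have hneg := h.1.1
  have hle1 := greene_le (n := n) (j := 1) (w := w)
  have hle2 := greene_le (n := n) (j := 2) (w := w)
  have hle3 := greene_le (n := n) (j := 3) (w := w)
  by_cases hdec : ∃ x ∈ positions n, ∃ y ∈ positions n, ∃ z ∈ positions n,
      x < y ∧ y < z ∧ w y < w x ∧ w z < w y
  · obtain ⟨x, hx, y, hy, z, hz, hxy, hyz, hwxy, hwyz⟩ := hdec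
    have hxz := h.eq_neg_of_decreasing hx hy hz hxy hyz hwxy hwyz
    subst hxz
    have hz' := mem_positions.1 hz
    have hy' := mem_positions.1 hy
    have hwz := hneg z
    have hjz : |w (|y|)| < -w z := by
      have hwy := hneg y
      rcases abs_choice y with e | e <;> rw [e, abs_lt] <;> omega
    have hj1 : 1 ≤ |y| := Int.one_le_abs hy'.1
    have hj2 : |y| < z := abs_lt.2 ⟨hxy, hyz⟩
    obtain ⟨r, hr⟩ := h.even_greene_one hj1 hj2 hz'.2.2 hjz
    have hcol : Colored w ((positions n).erase (-z)) 2 := by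
      refine colored_two_of_avoids w.injective fun a ha b hb c hc hab hbc hwab hwbc => ?_
      rw [Finset.mem_erase] at ha hb hc
      have hac := h.eq_neg_of_decreasing ha.2 hb.2 hc.2 hab hbc hwab hwbc
      subst hac
      have hc' := mem_positions.1 hc.2
      have hwc := hneg c
      have := h.pos_of_ne hj1 hj2 hz'.2.2 hjz (m := c) (by omega) hc'.2.2 (by omega)
      omega
    have hcard : ((positions n).erase (-z)).card = 2 * n - 1 := by
      rw [Finset.card_erase_of_mem hx, card_positions]
    have hn : 1 ≤ n := by omega
    have hhalf := hcol.card_le_two_mul_greene_one hneg (Finset.erase_subset _ _)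
    have hge2 := hcol.card_le_greene hneg (Finset.erase_subset _ _)
    have hcol3 := hcol.insert (-z)
    rw [Finset.insert_erase hx] at hcol3
    have hge3 : _ ≤ greene n w 3 := hcol3.card_le_greene hneg subset_rfl
    rw [card_positions] at hge3
    have hlt2 : greene n w 2 ≠ 2 * n := fun e => by
      obtain ⟨P, hP, hcolP, hcardP⟩ := exists_colored_card_eq_greene (n := n) two_pos hneg
      have heq := Finset.eq_of_subset_of_card_le hP (by rw [card_positions, hcardP, e])
      subst heq
      exact hcolP.not_decreasing_triple hx hy hz hxy hyz hwxy hwyz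
    have hlt1 : greene n w 1 ≠ 2 * n := fun e => by
      obtain ⟨P, hP, ⟨c, hc⟩, hcardP⟩ := exists_colored_card_eq_greene (n := n) one_pos hneg
      have heq := Finset.eq_of_subset_of_card_le hP (by rw [card_positions, hcardP, e])
      subst heq
      exact (hc _ hx y hy hxy (Subsingleton.elim _ _)).not_gt hwxy
    exact Or.inr ⟨n - r, by omega, by omega, by omega, by omega, by omega⟩
  · have hcol : Colored w (positions n) 2 :=
      colored_two_of_avoids w.injective fun x hx y hy z hz hxy hyz hwxy hwyz =>
        hdec ⟨x, hx, y, hy, z, hz, hxy, hyz, hwxy, hwyz⟩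
    have hhalf := hcol.card_le_two_mul_greene_one hneg subset_rfl
    have hge2 := hcol.card_le_greene hneg subset_rfl
    rw [card_positions] at hhalf hge2
    exact Or.inl ⟨2 * n - greene n w 1, by omega, by omega, by omega⟩

theorem FC_iff_admissible_shape (n : ℕ) (hn : 0 < n) (w : Equiv.Perm ℤ) (hw : InB n w) :
    IsFC n w ↔
      ((∃ k ≤ n, greene n w 1 = 2 * n - k ∧ greene n w 2 = 2 * n) ∨
       (∃ k, 1 ≤ k ∧ 2 * k ≤ n ∧ greene n w 1 = 2 * n - 2 * k ∧
         greene n w 2 = 2 * n - 1 ∧ greene n w 3 = 2 * n)) := by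
  refine ⟨fun h => h.admissible, ?_⟩
  rintro (⟨k, -, -, h2⟩ | ⟨k, -, -, -, h2, -⟩) <;> exact isFC_of_greene_two hw (by omega)

end Paper
end
end

section
/- Let n be a positive integer, A⊆S_n, and suppose that Σ_{w∈A} F_{Des(w)}(x_1,x_2,…) = Σ_{λ⊢n} c_λ·s_λ(x_1,x_2,…) for some coefficients c_λ (i.e., the quasi-symmetric generating function of A is symmetric). Then Σ_{w∈A} F^B_{Des(w)}(x_0,x_1,…) = Σ_{λ⊢n} c_λ·s_λ(x_0,x_1,…); that is, the Chow type-B quasi-symmetric generating function of A is symmetric in x_0,x_1,… with the same Schur coefficients. -/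
open scoped Classical

noncomputable section

namespace Paper

/-- The exponent of the monomial obtained by the substitution `x_v ↦ x_{v+1}`. -/
def shiftExp (m : ℕ →₀ ℕ) : ℕ →₀ ℕ := m.mapDomain Nat.succ

lemma shiftExp_zero (m : ℕ →₀ ℕ) : shiftExp m 0 = 0 :=
  Finsupp.mapDomain_of_notMem_range _ _ (by simp)

lemma shiftExp_succ (m : ℕ →₀ ℕ) (v : ℕ) : shiftExp m (v + 1) = m v :=
  Finsupp.mapDomain_apply Nat.succ_injective m v

/-- When `0 ∉ J`, the series `FB` is `FA` after renaming `x_1, x_2, …` to `x_0, x_1, …`. -/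
lemma FB_apply_eq_FA_shiftExp (R : Type) [CommRing R] (n : ℕ) (J : Finset ℕ)
    (hJ : J ⊆ Finset.Ico 1 n) (m : ℕ →₀ ℕ) :
    FB R n J m = FA R n J (shiftExp m) := by
  unfold FB FA
  congr 1
  refine Nat.card_congr
    { toFun := fun f => ⟨fun a => if 1 ≤ a ∧ a ≤ n then f.1 a + 1 else 0, ?_⟩
      invFun := fun f => ⟨fun a => f.1 a - 1, ?_⟩
      left_inv := ?_
      right_inv := ?_ }
  · obtain ⟨f, h0, hn, hmono, hdes, hcont⟩ := f
    refine ⟨by simp, fun a ha => if_neg (by omega), fun a h1 h2 => ?_,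
      fun a b h1 h2 h3 => ?_, fun j hj => ?_, fun v => ?_⟩
    · simp [h1, h2]
    · have := hmono a b h2 h3
      simp only
      rw [if_pos (by omega), if_pos (by omega)]
      omega
    · have hj' := Finset.mem_Ico.1 (hJ hj)
      have := hdes j hj
      simp only
      rw [if_pos (by omega), if_pos (by omega)]
      omega
    · cases v with
      | zero =>
        rw [shiftExp_zero, eq_comm, Finset.card_eq_zero, Finset.filter_eq_empty_iff]
        intro a ha
        simp [Finset.mem_Icc.1 ha]
      | succ v =>
        rw [shiftExp_succ, hcont v]
        congr 1
        refine Finset.filter_congr fun a ha => ?_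
        simp [Finset.mem_Icc.1 ha]
  · obtain ⟨f, h0, hn, hpos, hmono, hdes, hcont⟩ := f
    refine ⟨by simp [h0], fun a ha => by simp [hn a ha], fun a b h1 h2 => ?_,
      fun j hj => ?_, fun v => ?_⟩
    · rcases Nat.eq_zero_or_pos a with rfl | ha
      · simp [h0]
      · exact Nat.sub_le_sub_right (hmono a b ha h1 h2) 1
    · have hj' := Finset.mem_Ico.1 (hJ hj)
      have := hdes j hj
      have := hpos j hj'.1 hj'.2.le
      simp only
      omega
    · rw [← shiftExp_succ, hcont (v + 1)]
      congr 1
      refine Finset.filter_congr fun a ha => ?_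
      have ha' := Finset.mem_Icc.1 ha
      have := hpos a ha'.1 ha'.2
      simp only
      omega
  · rintro ⟨f, h0, hn, -⟩
    ext a
    by_cases ha : 1 ≤ a ∧ a ≤ n
    · simp [ha]
    · rcases Nat.eq_zero_or_pos a with rfl | ha0
      · simp [h0]
      · simp [ha, hn a (by omega)]
  · rintro ⟨f, h0, hn, hpos, -⟩
    ext a
    by_cases ha : 1 ≤ a ∧ a ≤ n
    · have := hpos a ha.1 ha.2
      simp only [ha, and_self, if_true]
      omega
    · rcases Nat.eq_zero_or_pos a with rfl | ha0
      · simp [h0]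
      · simp [ha, hn a (by omega)]

/-- The Schur function in `x_0, x_1, …` is the one in `x_1, x_2, …` after renaming variables. -/
lemma schurS_zero_apply_eq_schurS_one_shiftExp (R : Type) [CommRing R] (lam : ℕ → ℕ)
    (hlam : Antitone lam) (m : ℕ →₀ ℕ) :
    schurS R 0 lam m = schurS R 1 lam (shiftExp m) := by
  unfold schurS schurCoeff
  congr 1
  refine Nat.card_congr
    { toFun := fun T => ⟨fun i j => if j < lam i then T.1 i j + 1 else 0, ?_⟩
      invFun := fun T => ⟨fun i j => T.1 i j - 1, ?_⟩
      left_inv := ?_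
      right_inv := ?_ }
  · obtain ⟨T, hrow, hcol, -, hout, hcont⟩ := T
    refine ⟨fun i j hj => ?_, fun i j hj => ?_, fun i j hj => ?_, fun i j hj => if_neg hj,
      fun v => ?_⟩
    · have := hrow i j hj
      simp only
      rw [if_pos (by omega), if_pos hj]
      omega
    · have := hcol i j hj
      simp only
      rw [if_pos (hj.trans_le (hlam i.le_succ)), if_pos hj]
      omega
    · simp [hj]
    · cases v with
      | zero =>
        simp only
        rw [shiftExp_zero, eq_comm, Nat.card_eq_zero]
        left
        constructor
        rintro ⟨p, hp, hT⟩
        simp [hp] at hT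
      | succ v =>
        refine (shiftExp_succ m v).trans ((hcont v).trans ?_)
        refine Nat.card_congr (Equiv.subtypeEquivRight fun p => and_congr_right fun hp => ?_)
        simp [hp]
  · obtain ⟨T, hrow, hcol, hpos, hout, hcont⟩ := T
    refine ⟨fun i j hj => Nat.sub_le_sub_right (hrow i j hj) 1, fun i j hj => ?_,
      fun i j hj => Nat.zero_le _, fun i j hj => by simp [hout i j hj], fun v => ?_⟩
    · have := hcol i j hj
      have := hpos i j (hj.trans_le (hlam i.le_succ))
      simp only
      omega
    · refine (shiftExp_succ m v).symm.trans ((hcont (v + 1)).trans ?_)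
      refine Nat.card_congr (Equiv.subtypeEquivRight fun p => and_congr_right fun hp => ?_)
      have := hpos p.1 p.2 hp
      simp only
      omega
  · rintro ⟨T, -, -, -, hout, -⟩
    ext i j
    by_cases hj : j < lam i
    · simp [hj]
    · simp [hj, hout i j hj]
  · rintro ⟨T, -, -, hpos, hout, -⟩
    ext i j
    by_cases hj : j < lam i
    · have := hpos i j hj
      simp only [hj, if_true]
      omega
    · simp [hj, hout i j hj]

lemma partFun_antitone {k : ℕ} (p : Nat.Partition k) : Antitone (partFun p) := by
  intro i j hij
  unfold partFun
  have hs : ((p.parts.sort (· ≤ ·)).reverse).Pairwise (· ≥ ·) := by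
    rw [List.pairwise_reverse]
    exact Multiset.pairwise_sort _ _
  generalize (p.parts.sort (· ≤ ·)).reverse = l at hs
  rcases hij.eq_or_lt with rfl | hij
  · exact le_rfl
  by_cases hj : j < l.length
  · rw [List.getD_eq_getElem _ _ hj, List.getD_eq_getElem _ _ (hij.trans hj)]
    exact List.pairwise_iff_getElem.1 hs i j _ _ hij
  · rw [List.getD_eq_default _ _ (by omega)]
    exact Nat.zero_le _

theorem gessel_symmetric_implies_chow (n : ℕ) (hn : 0 < n)
    (A : Finset (Equiv.Perm ℤ)) (hA : ∀ w ∈ A, InS n w)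
    (c : Nat.Partition n → ℤ)
    (h : (∑ w ∈ A, FA ℤ n (DesA n w)) =
      ∑ lam : Nat.Partition n, c lam • schurS ℤ 1 (partFun lam)) :
    (∑ w ∈ A, FB ℤ n (DesA n w)) =
      ∑ lam : Nat.Partition n, c lam • schurS ℤ 0 (partFun lam) := by
  ext m
  have hm := congrArg (MvPowerSeries.coeff (shiftExp m)) h
  simp only [map_sum] at hm ⊢
  refine Eq.trans (Finset.sum_congr rfl fun w _ =>
    FB_apply_eq_FA_shiftExp ℤ n _ (Finset.filter_subset _ _) m) (hm.trans ?_)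
  exact Finset.sum_congr rfl fun lam _ => congrArg (c lam • ·)
    (schurS_zero_apply_eq_schurS_one_shiftExp ℤ _ (partFun_antitone lam) m).symm

end Paper
end
end

section
/- For every integer n≥3, the set FC(B_n) of fully commutative elements of the hyperoctahedral group B_n is not Poirier type-B Schur-positive: there exist no nonnegative coefficients c_{μ,ν}, indexed by pairs of partitions (μ,ν) with |μ|+|ν|=n, such that Σ_{w∈FC(B_n)} F^P_w(X,Y) = Σ_{(μ,ν)} c_{μ,ν}·s_μ(X)·s_ν(Y). -/
open scoped Classical

noncomputable section

namespace Paper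

/-! ### Coefficients of products of Schur functions -/

theorem finite_cells_partFun {k : ℕ} (p : Nat.Partition k) :
    {q : ℕ × ℕ | q.2 < partFun p q.1}.Finite := by
  refine ((Set.finite_lt_nat p.parts.card).biUnion (t := fun i =>
    ({i} : Set ℕ) ×ˢ Set.Iio (partFun p i)) fun i _ =>
      (Set.finite_singleton i).prod (Set.finite_Iio _)).subset ?_
  rintro ⟨i, j⟩ h
  simp only [Set.mem_ofPred_eq] at h
  simp only [Set.mem_iUnion, Set.mem_prod, Set.mem_singleton_iff, Set.mem_Iio,
    Set.mem_ofPred_eq, exists_prop]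
  refine ⟨i, ?_, rfl, h⟩
  by_contra hi
  have : partFun p i = 0 := by
    unfold partFun
    rw [List.getD_eq_default]
    simpa using hi
  omega

/-- Moving the entry of a one-cell tableau from `a` to `b`. -/
theorem schurCoeff_single_eq {lam : ℕ → ℕ} (hfin : {q : ℕ × ℕ | q.2 < lam q.1}.Finite)
    {a b : ℕ} (ha : 1 ≤ a) (hb : 1 ≤ b) :
    schurCoeff 1 lam (fun v => if v = a then 1 else 0) =
      schurCoeff 1 lam (fun v => if v = b then 1 else 0) := by
  have key : ∀ {a b : ℕ}, 1 ≤ a → 1 ≤ b → ∀ T : ℕ → ℕ → ℕ,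
      ((∀ i j, j + 1 < lam i → T i j ≤ T i (j + 1)) ∧
      (∀ i j, j < lam (i + 1) → T i j < T (i + 1) j) ∧
      (∀ i j, j < lam i → 1 ≤ T i j) ∧
      (∀ i j, ¬ j < lam i → T i j = 0) ∧
      ∀ v : ℕ, (if v = a then 1 else 0) =
        Nat.card {p : ℕ × ℕ // p.2 < lam p.1 ∧ T p.1 p.2 = v}) →
      ((∀ i j, j + 1 < lam i → Equiv.swap a b (T i j) ≤ Equiv.swap a b (T i (j + 1))) ∧
      (∀ i j, j < lam (i + 1) → Equiv.swap a b (T i j) < Equiv.swap a b (T (i + 1) j)) ∧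
      (∀ i j, j < lam i → 1 ≤ Equiv.swap a b (T i j)) ∧
      (∀ i j, ¬ j < lam i → Equiv.swap a b (T i j) = 0) ∧
      ∀ v : ℕ, (if v = b then 1 else 0) =
        Nat.card {p : ℕ × ℕ // p.2 < lam p.1 ∧ Equiv.swap a b (T p.1 p.2) = v}) := by
    rintro a b ha hb T ⟨-, hcol, -, hout, hcont⟩
    have hcell : ∀ i j, j < lam i → T i j = a := by
      intro i j hij
      by_contra hne
      have h := hcont (T i j)
      rw [if_neg hne] at h
      have : Finite {p : ℕ × ℕ // p.2 < lam p.1 ∧ T p.1 p.2 = T i j} :=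
        (hfin.subset fun q hq => hq.1 : {p : ℕ × ℕ | p.2 < lam p.1 ∧ T p.1 p.2 = T i j}.Finite)
      have : Nonempty {p : ℕ × ℕ // p.2 < lam p.1 ∧ T p.1 p.2 = T i j} := ⟨⟨(i, j), hij, rfl⟩⟩
      have := Nat.card_pos (α := {p : ℕ × ℕ // p.2 < lam p.1 ∧ T p.1 p.2 = T i j})
      omega
    have hzero : Equiv.swap a b 0 = 0 :=
      Equiv.swap_apply_of_ne_of_ne (by omega) (by omega)
    refine ⟨fun i j h => ?_, fun i j h => ?_, fun i j h => ?_, fun i j h => ?_, fun v => ?_⟩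
    · rw [hcell i j (by omega), hcell i (j + 1) h]
    · have h1 := hcol i j h
      rw [hcell _ j h] at h1 ⊢
      by_cases h2 : j < lam i
      · rw [hcell i j h2] at h1
        omega
      · rw [hout i j h2, hzero, Equiv.swap_apply_left]
        omega
    · rw [hcell i j h, Equiv.swap_apply_left]
      exact hb
    · rw [hout i j h, hzero]
    · have h := hcont (Equiv.swap a b v)
      have e : (Equiv.swap a b v = a) ↔ v = b := by
        rw [Equiv.swap_apply_eq_iff, Equiv.swap_apply_left]
      simp only [e] at h
      rw [h]
      simp only [Equiv.swap_apply_eq_iff]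
  unfold schurCoeff
  refine Nat.card_congr
    { toFun := fun T => ⟨fun i j => Equiv.swap a b (T.1 i j), key ha hb T.1 T.2⟩
      invFun := fun T => ⟨fun i j => Equiv.swap a b (T.1 i j), ?_⟩
      left_inv := fun T => by ext; simp
      right_inv := fun T => by ext; simp }
  rw [Equiv.swap_comm]
  exact key hb ha T.1 T.2

theorem coeff_schurX_mul_schurY (lam nu : ℕ → ℕ) {p q : ℕ ⊕ ℕ →₀ ℕ}
    (hp : ∀ v, p (Sum.inr v) = 0) (hq : ∀ v, q (Sum.inl v) = 0) :
    MvPowerSeries.coeff (p + q) (schurX lam * schurY nu) =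
      (schurCoeff 1 lam fun v => p (Sum.inl v) : ℤ) *
        (schurCoeff 1 nu fun v => q (Sum.inr v) : ℤ) := by
  rw [MvPowerSeries.coeff_mul, Finset.sum_eq_single (p, q)]
  · have h1 : MvPowerSeries.coeff p (schurX lam) =
        (schurCoeff 1 lam fun v => p (Sum.inl v) : ℤ) := if_pos hp
    have h2 : MvPowerSeries.coeff q (schurY nu) =
        (schurCoeff 1 nu fun v => q (Sum.inr v) : ℤ) := if_pos hq
    rw [h1, h2]
  · rintro ⟨p', q'⟩ hpq hne
    rw [Finset.HasAntidiagonal.mem_antidiagonal] at hpq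
    by_cases h1 : ∀ v, p' (Sum.inr v) = 0
    · by_cases h2 : ∀ v, q' (Sum.inl v) = 0
      · refine absurd ?_ hne
        have hs := fun s => DFunLike.congr_fun hpq s
        simp only [Finsupp.add_apply] at hs
        ext s
        · rcases s with v | v
          · have := hs (Sum.inl v); have := h2 v; have := hq v
            simp only; omega
          · have := h1 v; have := hp v
            simp only; omega
        · rcases s with v | v
          · have := h2 v; have := hq v
            simp only; omega
          · have := hs (Sum.inr v); have := h1 v; have := hp v
            simp only; omega
      · have : MvPowerSeries.coeff q' (schurY nu) = 0 := if_neg h2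
        simp only [this, mul_zero]
    · have : MvPowerSeries.coeff p' (schurX lam) = 0 := if_neg h1
      simp only [this, zero_mul]
  · intro h
    simp at h

/-! ### The monomials `x_1^{n-2} x_2 y_j` -/

/-- Exponent of `x_1^{n-2} x_2`. -/
def xExp (n : ℕ) : ℕ ⊕ ℕ →₀ ℕ :=
  Finsupp.single (Sum.inl 1) (n - 2) + Finsupp.single (Sum.inl 2) 1

/-- Exponent of `x_1^{n-2} x_2 y_j`. -/
def xyExp (n j : ℕ) : ℕ ⊕ ℕ →₀ ℕ := xExp n + Finsupp.single (Sum.inr j) 1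

theorem xyExp_inl (n j v : ℕ) :
    xyExp n j (Sum.inl v) = if v = 1 then n - 2 else if v = 2 then 1 else 0 := by
  simp only [xyExp, xExp, Finsupp.add_apply, Finsupp.single_apply, Sum.inl.injEq, reduceCtorEq,
    eq_comm (b := v), if_false]
  split_ifs <;> lia

theorem xyExp_inr (n j v : ℕ) :
    xyExp n j (Sum.inr v) = if v = j then 1 else 0 := by
  simp only [xyExp, xExp, Finsupp.add_apply, Finsupp.single_apply, Sum.inr.injEq, reduceCtorEq,
    eq_comm (b := v), if_false, zero_add]

theorem coeff_xyExp_schur {k l : ℕ} (n : ℕ) (mu : Nat.Partition k) (nu : Nat.Partition l)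
    {a b : ℕ} (ha : 1 ≤ a) (hb : 1 ≤ b) :
    MvPowerSeries.coeff (xyExp n a) (schurX (partFun mu) * schurY (partFun nu)) =
      MvPowerSeries.coeff (xyExp n b) (schurX (partFun mu) * schurY (partFun nu)) := by
  have hx : ∀ v, xExp n (Sum.inr v) = 0 := fun v => by simp [xExp]
  have hy : ∀ j v, (Finsupp.single (Sum.inr j) 1 : ℕ ⊕ ℕ →₀ ℕ) (Sum.inl v) = 0 :=
    fun j v => by simp
  have hj : ∀ j, (fun v => (Finsupp.single (Sum.inr j) 1 : ℕ ⊕ ℕ →₀ ℕ) (Sum.inr v)) =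
      fun v => if v = j then 1 else 0 := fun j => by
    ext v
    simp only [Finsupp.single_apply, Sum.inr.injEq, eq_comm]
  rw [xyExp, xyExp, coeff_schurX_mul_schurY _ _ hx (hy a),
    coeff_schurX_mul_schurY _ _ hx (hy b), hj, hj,
    schurCoeff_single_eq (finite_cells_partFun nu) ha hb]

/-! ### Signed permutations -/

theorem InB.abs_le {n : ℕ} {w : Equiv.Perm ℤ} (hw : InB n w) {i : ℤ} (hi : |i| ≤ n) :
    |w i| ≤ n := by
  by_contra h
  have h1 := w.injective (hw.2 (w i) (by omega))
  rw [h1] at h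
  exact h hi

theorem InB.apply_zero {n : ℕ} {w : Equiv.Perm ℤ} (hw : InB n w) : w 0 = 0 := by
  have := hw.1 0
  simp only [neg_zero] at this
  omega

theorem InB.apply_ne_zero {n : ℕ} {w : Equiv.Perm ℤ} (hw : InB n w) {i : ℤ} (hi : i ≠ 0) :
    w i ≠ 0 := fun h => hi (w.injective (h.trans hw.apply_zero.symm))

theorem finite_isFC (n : ℕ) : {w : Equiv.Perm ℤ | IsFC n w}.Finite := by
  have : Finite {w : Equiv.Perm ℤ // InB n w} := by
    refine Finite.of_injective
      (β := Finset.Icc (-n : ℤ) n → Finset.Icc (-n : ℤ) n)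
      (fun w i => ⟨w.1 i.1, Finset.mem_Icc.2 (abs_le.1 (w.2.abs_le
        (abs_le.2 (Finset.mem_Icc.1 i.2))))⟩) ?_
    intro w w' h
    ext i
    by_cases hi : |i| ≤ n
    · have := congrFun h ⟨i, Finset.mem_Icc.2 (abs_le.1 hi)⟩
      exact congrArg Subtype.val this
    · rw [w.2.2 i (by omega), w'.2.2 i (by omega)]
  exact Set.Finite.subset (s := {w : Equiv.Perm ℤ | InB n w}) this fun w hw => hw.1

/-! ### The sequences counted by `F^P_w` at `x_1^{n-2} x_2 y_j` -/

/-- The sequences counted by the coefficient of `F^P_w` at the exponent `m`. -/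
def IsFPSeq (n : ℕ) (w : Equiv.Perm ℤ) (m : ℕ ⊕ ℕ →₀ ℕ) (f : ℕ → ℕ) : Prop :=
  f 0 = 0 ∧ (∀ a, n < a → f a = 0) ∧
    (∀ a, 1 ≤ a → a ≤ n → 1 ≤ f a) ∧
    (∀ a b, 1 ≤ a → a ≤ b → b ≤ n → f a ≤ f b) ∧
    (∀ j ∈ rDes n w, f j < f (j + 1)) ∧
    (∀ v : ℕ, m (Sum.inl v) =
      ((Finset.Icc 1 n).filter fun a => f a = v ∧ 0 < w ((a : ℕ) : ℤ)).card) ∧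
    ∀ v : ℕ, m (Sum.inr v) =
      ((Finset.Icc 1 n).filter fun a => f a = v ∧ w ((a : ℕ) : ℤ) < 0).card

theorem coeff_FP (n : ℕ) (w : Equiv.Perm ℤ) (m : ℕ ⊕ ℕ →₀ ℕ) :
    MvPowerSeries.coeff m (FP n w) = (Nat.card {f : ℕ → ℕ // IsFPSeq n w m f} : ℤ) := rfl

theorem coeff_FP_nonneg (n : ℕ) (w : Equiv.Perm ℤ) (m : ℕ ⊕ ℕ →₀ ℕ) :
    0 ≤ MvPowerSeries.coeff m (FP n w) := by
  rw [coeff_FP]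
  positivity

theorem IsFPSeq.sign_value {n j : ℕ} {w : Equiv.Perm ℤ} {f : ℕ → ℕ}
    (hw : InB n w) (hf : IsFPSeq n w (xyExp n j) f) {a : ℕ} (ha : 1 ≤ a) (han : a ≤ n) :
    (0 < w (a : ℤ) ∧ (f a = 1 ∨ f a = 2)) ∨ (w (a : ℤ) < 0 ∧ f a = j) := by
  obtain ⟨-, -, -, -, -, hX, hY⟩ := hf
  have h0 : w (a : ℤ) ≠ 0 := hw.apply_ne_zero (by omega)
  rcases lt_or_gt_of_ne h0 with h | h
  · refine Or.inr ⟨h, ?_⟩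
    by_contra hne
    have h1 := hY (f a)
    rw [xyExp_inr, if_neg hne, eq_comm, Finset.card_eq_zero] at h1
    exact Finset.notMem_empty a (h1 ▸ Finset.mem_filter.2 ⟨Finset.mem_Icc.2 ⟨ha, han⟩, rfl, h⟩)
  · refine Or.inl ⟨h, ?_⟩
    by_contra! hne
    have h1 := hX (f a)
    rw [xyExp_inl, if_neg hne.1, if_neg hne.2, eq_comm, Finset.card_eq_zero] at h1
    exact Finset.notMem_empty a (h1 ▸ Finset.mem_filter.2 ⟨Finset.mem_Icc.2 ⟨ha, han⟩, rfl, h⟩)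

theorem finite_isFPSeq {n j : ℕ} {w : Equiv.Perm ℤ} (hw : InB n w) :
    Finite {f : ℕ → ℕ // IsFPSeq n w (xyExp n j) f} := by
  have hb : ∀ f : {f : ℕ → ℕ // IsFPSeq n w (xyExp n j) f}, ∀ a, a ≤ n → f.1 a < j + 3 := by
    rintro ⟨f, hf⟩ a ha
    rcases Nat.eq_zero_or_pos a with rfl | h
    · have := hf.1
      simp only
      omega
    · have := hf.sign_value hw h ha
      simp only
      omega
  refine Finite.of_injective (β := Fin (n + 1) → Fin (j + 3))
    (fun f a => ⟨f.1 a, hb f a (by omega)⟩) ?_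
  intro f g h
  ext a
  by_cases ha : a ≤ n
  · exact congrArg Fin.val (congrFun h ⟨a, by omega⟩)
  · rw [f.2.2.1 a (by omega), g.2.2.1 a (by omega)]

theorem IsFPSeq.eq_of_three {n : ℕ} (hn : 3 ≤ n) {w : Equiv.Perm ℤ} {f : ℕ → ℕ}
    (hw : InB n w) (hf : IsFPSeq n w (xyExp n 3) f) :
    (∀ a, 1 ≤ a → a ≤ n - 2 → f a = 1) ∧ f (n - 1) = 2 ∧ f n = 3 := by
  have hs := fun {a : ℕ} => hf.sign_value hw (a := a)
  obtain ⟨-, -, -, hmono, -, hX, hY⟩ := hf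
  have hX1 := hX 1
  have hX2 := hX 2
  have hY3 := hY 3
  simp only [xyExp_inl, xyExp_inr, if_true, if_false, OfNat.ofNat_ne_one] at hX1 hX2 hY3
  have hpair : ∀ s : Finset ℕ, s.card = 1 → n - 1 ∈ s → n ∈ s → False := by
    intro s h1 h2 h3
    have := Finset.card_le_one.1 h1.le _ h2 _ h3
    omega
  have h1 : f (n - 1) ≠ 1 := by
    intro h
    have : Finset.Icc 1 (n - 1) ⊆
        (Finset.Icc 1 n).filter fun a => f a = 1 ∧ 0 < w ((a : ℕ) : ℤ) := by
      intro a ha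
      rw [Finset.mem_Icc] at ha
      have h1 := hmono a (n - 1) ha.1 ha.2 (by omega)
      have h2 := hs ha.1 (by omega)
      refine Finset.mem_filter.2 ⟨Finset.mem_Icc.2 (by omega), ?_⟩
      omega
    have := Finset.card_le_card this
    rw [Nat.card_Icc] at this
    omega
  have hlow : ∀ a, 1 ≤ a → a ≤ n - 2 → f a = 1 := by
    intro a ha han
    by_contra hne
    have : ((Finset.Icc 1 n).filter fun a => f a = 1 ∧ 0 < w ((a : ℕ) : ℤ)) ⊆
        Finset.Icc 1 (a - 1) := by
      intro b hb
      rw [Finset.mem_filter, Finset.mem_Icc] at hb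
      rw [Finset.mem_Icc]
      by_contra hba
      have h1 := hmono a b ha (by omega) hb.1.2
      have h2 := hs ha (by omega)
      omega
    have := Finset.card_le_card this
    rw [Nat.card_Icc] at this
    omega
  have s1 := hs (a := n - 1) (by omega) (by omega)
  have s2 := hs (a := n) (by omega) le_rfl
  have hm := hmono (n - 1) n (by omega) (by omega) le_rfl
  refine ⟨hlow, ?_⟩
  have m1 : n - 1 ∈ Finset.Icc 1 n := Finset.mem_Icc.2 (by omega)
  have m2 : n ∈ Finset.Icc 1 n := Finset.mem_Icc.2 (by omega)
  rcases s1 with ⟨p1, q1⟩ | ⟨p1, q1⟩ <;> rcases s2 with ⟨p2, q2⟩ | ⟨p2, q2⟩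
  · exact (hpair _ hX2.symm (Finset.mem_filter.2 ⟨m1, by omega, p1⟩)
      (Finset.mem_filter.2 ⟨m2, by omega, p2⟩)).elim
  · omega
  · omega
  · exact (hpair _ hY3.symm (Finset.mem_filter.2 ⟨m1, by omega, p1⟩)
      (Finset.mem_filter.2 ⟨m2, by omega, p2⟩)).elim

theorem coeff_FP_three_le_one {n : ℕ} (hn : 3 ≤ n) {w : Equiv.Perm ℤ} (hw : InB n w) :
    MvPowerSeries.coeff (xyExp n 3) (FP n w) ≤ 1 := by
  rw [coeff_FP]
  have : Subsingleton {f : ℕ → ℕ // IsFPSeq n w (xyExp n 3) f} := by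
    refine ⟨fun f g => ?_⟩
    obtain ⟨f1, f2, f3⟩ := f.2.eq_of_three hn hw
    obtain ⟨g1, g2, g3⟩ := g.2.eq_of_three hn hw
    ext a
    rcases Nat.eq_zero_or_pos a with rfl | h
    · rw [f.2.1, g.2.1]
    by_cases h1 : a ≤ n - 2
    · rw [f1 a h h1, g1 a h h1]
    by_cases h2 : n < a
    · rw [f.2.2.1 a h2, g.2.2.1 a h2]
    · obtain rfl | rfl : a = n - 1 ∨ a = n := by omega
      · rw [f2, g2]
      · rw [f3, g3]
  exact_mod_cast Finite.card_le_one_iff_subsingleton.2 this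

/-- A fully commutative `w` whose function `F^P_w` involves `x_1^{n-2} x_2 y_3` is positive and
increasing on `1, …, n-1` and negative at `n`. -/
theorem IsFC.of_coeff_three_ne_zero {n : ℕ} (hn : 3 ≤ n) {w : Equiv.Perm ℤ} (hw : IsFC n w)
    (h : MvPowerSeries.coeff (xyExp n 3) (FP n w) ≠ 0) :
    w (n : ℤ) < 0 ∧ (∀ a : ℕ, 1 ≤ a → a < n → 0 < w (a : ℤ)) ∧
      ∀ a b : ℕ, 1 ≤ a → a < b → b < n → w (a : ℤ) < w (b : ℤ) := by
  rw [coeff_FP, Nat.cast_ne_zero] at h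
  obtain ⟨⟨f, hf⟩⟩ := (Nat.card_ne_zero.1 h).1
  obtain ⟨h1, h2, h3⟩ := hf.eq_of_three hn hw.1
  have hs := fun {a : ℕ} => hf.sign_value hw.1 (a := a)
  have hneg : w (n : ℤ) < 0 := by
    have := hs (a := n) (by omega) le_rfl
    omega
  have hpos : ∀ a : ℕ, 1 ≤ a → a < n → 0 < w (a : ℤ) := by
    intro a ha han
    have := hs ha han.le
    by_cases h4 : a ≤ n - 2
    · have := h1 a ha h4
      omega
    · obtain rfl : a = n - 1 := by omega
      omega
  refine ⟨hneg, hpos, fun a b ha hab hb => ?_⟩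
  have hpa := hpos a ha (by omega)
  have hpb := hpos b (by omega) hb
  have hne : w (a : ℤ) ≠ w (b : ℤ) := fun h => by
    have := w.injective h
    omega
  by_contra hlt
  exact hw.2.2.1 ⟨a, b, n, ha, hab, hb, le_rfl, by rw [abs_of_pos hpa]; omega, by omega⟩

theorem one_le_coeff_FP_one {n : ℕ} (hn : 3 ≤ n) {w : Equiv.Perm ℤ} (hw : InB n w)
    (hneg : w 1 < 0) (hpos : ∀ a : ℕ, 2 ≤ a → a ≤ n → 0 < w (a : ℤ))
    (hinc : ∀ a : ℕ, 2 ≤ a → a + 1 < n → w (a : ℤ) < w ((a + 1 : ℕ) : ℤ)) :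
    1 ≤ MvPowerSeries.coeff (xyExp n 1) (FP n w) := by
  have := finite_isFPSeq (j := 1) hw
  suffices h : IsFPSeq n w (xyExp n 1)
      fun a => if a = 0 ∨ n < a then 0 else if a = n then 2 else 1 by
    have : Nonempty {f : ℕ → ℕ // IsFPSeq n w (xyExp n 1) f} := ⟨⟨_, h⟩⟩
    rw [coeff_FP]
    exact_mod_cast Nat.card_pos
  have hsign : ∀ a : ℕ, 1 ≤ a → a ≤ n → (0 < w (a : ℤ) ↔ a ≠ 1) := by
    intro a ha han
    by_cases h : a = 1
    · subst h
      simp only [Nat.cast_one, ne_eq, not_true_eq_false, iff_false]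
      omega
    · simp only [hpos a (by omega) han, ne_eq, h, not_false_eq_true]
  have hsign' : ∀ a : ℕ, 1 ≤ a → a ≤ n → (w (a : ℤ) < 0 ↔ a = 1) := by
    intro a ha han
    by_cases h : a = 1
    · subst h
      simpa using hneg
    · have := hpos a (by omega) han
      constructor <;> intro <;> omega
  refine ⟨by simp, fun a ha => by simp [ha], fun a ha han => ?_, fun a b ha hab hb => ?_,
    fun j hj => ?_, fun v => ?_, fun v => ?_⟩
  · simp only
    split_ifs <;> lia
  · simp only
    split_ifs <;> lia
  · simp only [rDes, Finset.mem_filter, Finset.mem_Ico] at hj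
    obtain ⟨⟨hj1, hjn⟩, hd⟩ := hj
    have hj' : j + 1 = n := by
      by_contra hne
      have hp := hpos (j + 1) (by omega) (by omega)
      by_cases h1 : j = 1
      · subst h1
        have hb := (abs_le.1 (hw.abs_le (i := 1) (by simp; omega))).1
        simp only [rkey, Nat.cast_one, hneg, if_true, not_lt.2 hp.le, if_false] at hd
        omega
      · have hp' := hpos j (by omega) (by omega)
        have := hinc j (by omega) (by omega)
        simp only [rkey, not_lt.2 hp.le, not_lt.2 hp'.le, if_false] at hd
        omega
    simp only
    split_ifs <;> lia
  · rw [xyExp_inl]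
    split_ifs with h1 h2
    · have : ((Finset.Icc 1 n).filter fun a =>
          (if a = 0 ∨ n < a then 0 else if a = n then 2 else 1) = v ∧ 0 < w ((a : ℕ) : ℤ)) =
          Finset.Icc 2 (n - 1) := by
        ext a
        simp only [Finset.mem_filter, Finset.mem_Icc]
        constructor
        · rintro ⟨⟨h3, h4⟩, h5, h6⟩
          have := (hsign a h3 h4).1 h6
          split_ifs at h5 <;> omega
        · rintro ⟨h3, h4⟩
          refine ⟨by omega, ?_, hpos a h3 (by omega)⟩
          split_ifs <;> lia
      rw [this, Nat.card_Icc]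
      omega
    · rw [eq_comm, Finset.card_eq_one]
      refine ⟨n, ?_⟩
      ext a
      simp only [Finset.mem_filter, Finset.mem_Icc, Finset.mem_singleton]
      constructor
      · rintro ⟨⟨h3, h4⟩, h5, h6⟩
        split_ifs at h5 <;> omega
      · rintro rfl
        refine ⟨by omega, ?_, hpos a (by omega) le_rfl⟩
        split_ifs <;> lia
    · rw [eq_comm, Finset.card_eq_zero, Finset.filter_eq_empty_iff]
      rintro a ha ⟨h5, -⟩
      rw [Finset.mem_Icc] at ha
      simp only at h5
      split_ifs at h5 <;> omega
  · rw [xyExp_inr]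
    split_ifs with h1
    · rw [eq_comm, Finset.card_eq_one]
      refine ⟨1, ?_⟩
      ext a
      simp only [Finset.mem_filter, Finset.mem_Icc, Finset.mem_singleton]
      constructor
      · rintro ⟨⟨h3, h4⟩, h5, h6⟩
        exact (hsign' a h3 h4).1 h6
      · rintro rfl
        refine ⟨by omega, ?_, by simpa using hneg⟩
        split_ifs <;> lia
    · rw [eq_comm, Finset.card_eq_zero, Finset.filter_eq_empty_iff]
      rintro a ha ⟨h5, h6⟩
      rw [Finset.mem_Icc] at ha
      have := (hsign' a ha.1 ha.2).1 h6
      simp only at h5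
      split_ifs at h5 <;> omega

/-- If all window entries after the first are positive, `w` is fully commutative as soon as no
descent `w_j > w_k` follows an entry `w_i` with `|w_i| > w_j`. -/
theorem isFC_of_first_neg {n : ℕ} {w : Equiv.Perm ℤ} (hw : InB n w)
    (hpos : ∀ a : ℕ, 2 ≤ a → a ≤ n → 0 < w (a : ℤ))
    (havoid : ∀ i j k : ℕ, 1 ≤ i → i < j → j < k → k ≤ n →
      w (j : ℤ) < |w (i : ℤ)| → w (j : ℤ) ≤ w (k : ℤ)) : IsFC n w := by
  refine ⟨hw, ?_, ?_, ?_⟩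
  · rintro ⟨i, j, hi, hij, hj, h1, h2⟩
    have := hpos j (by omega) hj
    omega
  · rintro ⟨i, j, k, hi, hij, hjk, hk, h1, h2⟩
    have := havoid i j k hi hij hjk hk h1
    omega
  · rintro ⟨i, j, k, hi, hij, hjk, hk, h1, h2⟩
    have := hpos j (by omega) (by omega)
    have := abs_nonneg (w (i : ℤ))
    omega

/-! ### Moving the last window entry to the front -/

/-- The odd permutation of `ℤ` with window `[n, 1, 2, …, n-1]`. -/
def rotPerm (n : ℕ) (hn : 3 ≤ n) : Equiv.Perm ℤ where
  toFun i := if i = 1 then n else if i = -1 then -n else if 2 ≤ i ∧ i ≤ n then i - 1 else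
    if i ≤ -2 ∧ -n ≤ i then i + 1 else i
  invFun i := if i = n then 1 else if i = -n then -1 else if 1 ≤ i ∧ i < n then i + 1 else
    if i ≤ -1 ∧ -n < i then i - 1 else i
  left_inv i := by
    simp only
    split_ifs <;> lia
  right_inv i := by
    simp only
    split_ifs <;> lia

theorem rotPerm_apply (n : ℕ) (hn : 3 ≤ n) (i : ℤ) :
    rotPerm n hn i = if i = 1 then (n : ℤ) else if i = -1 then -(n : ℤ) else
      if 2 ≤ i ∧ i ≤ n then i - 1 else if i ≤ -2 ∧ -(n : ℤ) ≤ i then i + 1 else i := rfl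

theorem rotPerm_one (n : ℕ) (hn : 3 ≤ n) : rotPerm n hn 1 = n := rfl

theorem rotPerm_of_two_le (n : ℕ) (hn : 3 ≤ n) {a : ℕ} (ha : 2 ≤ a) (han : a ≤ n) :
    rotPerm n hn a = (a - 1 : ℕ) := by
  rw [rotPerm_apply]
  split_ifs <;> lia

theorem inB_mul_rotPerm {n : ℕ} (hn : 3 ≤ n) {w : Equiv.Perm ℤ} (hw : InB n w) :
    InB n (w * rotPerm n hn) := by
  refine ⟨fun i => ?_, fun i hi => ?_⟩
  · rw [Equiv.Perm.mul_apply, Equiv.Perm.mul_apply, ← hw.1]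
    congr 1
    rw [rotPerm_apply, rotPerm_apply]
    split_ifs <;> lia
  · have : rotPerm n hn i = i := by
      rw [rotPerm_apply]
      rcases abs_cases i with h | h <;> split_ifs <;> lia
    rw [Equiv.Perm.mul_apply, this, hw.2 i hi]

theorem mul_rotPerm_spec {n : ℕ} (hn : 3 ≤ n) {w : Equiv.Perm ℤ} (hw : IsFC n w)
    (h : MvPowerSeries.coeff (xyExp n 3) (FP n w) ≠ 0) :
    IsFC n (w * rotPerm n hn) ∧
      1 ≤ MvPowerSeries.coeff (xyExp n 1) (FP n (w * rotPerm n hn)) := by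
  obtain ⟨hneg, hpos, hinc⟩ := hw.of_coeff_three_ne_zero hn h
  have hB := inB_mul_rotPerm hn hw.1
  have happ : ∀ a : ℕ, 2 ≤ a → a ≤ n →
      (w * rotPerm n hn) (a : ℤ) = w ((a - 1 : ℕ) : ℤ) := fun a ha han => by
    rw [Equiv.Perm.mul_apply, rotPerm_of_two_le n hn ha han]
  have hpos' : ∀ a : ℕ, 2 ≤ a → a ≤ n → 0 < (w * rotPerm n hn) (a : ℤ) := fun a ha han => by
    rw [happ a ha han]
    exact hpos _ (by omega) (by omega)
  have hinc' : ∀ a b : ℕ, 2 ≤ a → a < b → b ≤ n →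
      (w * rotPerm n hn) (a : ℤ) < (w * rotPerm n hn) (b : ℤ) := fun a b ha hab hb => by
    rw [happ a ha (by omega), happ b (by omega) hb]
    exact hinc _ _ (by omega) (by omega) (by omega)
  exact ⟨isFC_of_first_neg hB hpos' fun i j k hi hij hjk hk _ =>
      (hinc' j k (by omega) hjk hk).le,
    one_le_coeff_FP_one hn hB (by rw [Equiv.Perm.mul_apply, rotPerm_one]; exact hneg) hpos'
      fun a ha han => hinc' a (a + 1) ha (by omega) (by omega)⟩

/-! ### A further element contributing to `x_1^{n-2} x_2 y_1` -/

/-- The signed permutation `[-1, 2, …, n-2, n, n-1]`. -/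
def extraPerm (n : ℕ) : Equiv.Perm ℤ :=
  Equiv.swap 1 (-1) * (Equiv.swap (n : ℤ) (n - 1) * Equiv.swap (-n : ℤ) (1 - n))

theorem extraPerm_apply (n : ℕ) (hn : 3 ≤ n) (i : ℤ) :
    extraPerm n i = if i = 1 then -1 else if i = -1 then 1 else if i = n then (n : ℤ) - 1 else
      if i = (n : ℤ) - 1 then (n : ℤ) else if i = -(n : ℤ) then 1 - (n : ℤ) else
      if i = 1 - (n : ℤ) then -(n : ℤ) else i := by
  simp only [extraPerm, Equiv.Perm.mul_apply, Equiv.swap_apply_def]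
  split_ifs <;> lia

theorem extraPerm_of_nat {n : ℕ} (hn : 3 ≤ n) {a : ℕ} (ha : 2 ≤ a) (han : a ≤ n) :
    extraPerm n a = if a = n then (n : ℤ) - 1 else if a + 1 = n then (n : ℤ) else a := by
  rw [extraPerm_apply n hn]
  split_ifs <;> lia

theorem extraPerm_spec {n : ℕ} (hn : 3 ≤ n) :
    IsFC n (extraPerm n) ∧
      1 ≤ MvPowerSeries.coeff (xyExp n 1) (FP n (extraPerm n)) := by
  have hB : InB n (extraPerm n) := by
    refine ⟨fun i => ?_, fun i hi => ?_⟩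
    · rw [extraPerm_apply n hn, extraPerm_apply n hn]
      split_ifs <;> lia
    · rw [extraPerm_apply n hn]
      rcases abs_cases i with h | h <;> split_ifs <;> lia
  have hone : extraPerm n 1 = -1 := by
    rw [extraPerm_apply n hn]
    simp
  have hpos : ∀ a : ℕ, 2 ≤ a → a ≤ n → 0 < extraPerm n (a : ℤ) := fun a ha han => by
    rw [extraPerm_of_nat hn ha han]
    split_ifs <;> lia
  refine ⟨isFC_of_first_neg hB hpos fun i j k hi hij hjk hk h => ?_,
    one_le_coeff_FP_one hn hB (by omega) hpos fun a ha han => ?_⟩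
  · have hj := hpos j (by omega) (by omega)
    rcases Nat.lt_or_ge 1 i with h1 | h1
    · rw [abs_of_pos (hpos i (by omega) (by omega))] at h
      rw [extraPerm_of_nat hn (by omega) (by omega)] at h ⊢
      rw [extraPerm_of_nat hn (by omega) (by omega)] at h ⊢
      split_ifs at h ⊢ <;> omega
    · obtain rfl : i = 1 := by omega
      rw [Nat.cast_one, hone] at h
      norm_num at h
      omega
  · rw [extraPerm_of_nat hn ha (by omega), extraPerm_of_nat hn (by omega) (by omega)]
    split_ifs <;> lia

theorem extraPerm_ne_mul_rotPerm {n : ℕ} (hn : 3 ≤ n) {w : Equiv.Perm ℤ} (hw : IsFC n w)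
    (h : MvPowerSeries.coeff (xyExp n 3) (FP n w) ≠ 0) :
    w * rotPerm n hn ≠ extraPerm n := by
  intro heq
  obtain ⟨-, -, hinc⟩ := hw.of_coeff_three_ne_zero hn h
  have h1 := hinc (n - 1 - 1) (n - 1) (by omega) (by omega) (by omega)
  have hlast : ∀ a : ℕ, 2 ≤ a → a ≤ n → w ((a - 1 : ℕ) : ℤ) = extraPerm n a :=
    fun a ha han => by
      rw [← rotPerm_of_two_le n hn ha han, ← Equiv.Perm.mul_apply w, heq]
  rw [hlast (n - 1) (by omega) (by omega), hlast n (by omega) le_rfl,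
    extraPerm_of_nat hn (a := n - 1) (by omega) (by omega),
    extraPerm_of_nat hn (a := n) (by omega) le_rfl] at h1
  split_ifs at h1 <;> omega

theorem sum_coeff_FP_three_lt {n : ℕ} (hn : 3 ≤ n) :
    ∑ w ∈ (finite_isFC n).toFinset, MvPowerSeries.coeff (xyExp n 3) (FP n w) <
      ∑ w ∈ (finite_isFC n).toFinset, MvPowerSeries.coeff (xyExp n 1) (FP n w) := by
  set S := (finite_isFC n).toFinset with hS
  have hmem : ∀ {w}, w ∈ S ↔ IsFC n w := fun {w} => by simp [hS]
  set A := S.filter fun w => MvPowerSeries.coeff (xyExp n 3) (FP n w) ≠ 0 with hA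
  have hmemA : ∀ {w}, w ∈ A → IsFC n w ∧ MvPowerSeries.coeff (xyExp n 3) (FP n w) ≠ 0 :=
    fun {w} hw => by
      rw [hA, Finset.mem_filter] at hw
      exact ⟨hmem.1 hw.1, hw.2⟩
  have hsub : A.image (· * rotPerm n hn) ⊆ S := by
    intro u hu
    obtain ⟨w, hw, rfl⟩ := Finset.mem_image.1 hu
    exact hmem.2 (mul_rotPerm_spec hn (hmemA hw).1 (hmemA hw).2).1
  have hextra : extraPerm n ∉ A.image (· * rotPerm n hn) := by
    intro hu
    obtain ⟨w, hw, h⟩ := Finset.mem_image.1 hu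
    exact extraPerm_ne_mul_rotPerm hn (hmemA hw).1 (hmemA hw).2 h
  calc ∑ w ∈ S, MvPowerSeries.coeff (xyExp n 3) (FP n w)
      = ∑ w ∈ A, MvPowerSeries.coeff (xyExp n 3) (FP n w) := (Finset.sum_filter_ne_zero S).symm
    _ ≤ ∑ w ∈ A, MvPowerSeries.coeff (xyExp n 1) (FP n (w * rotPerm n hn)) :=
        Finset.sum_le_sum fun w hw => (coeff_FP_three_le_one hn (hmemA hw).1.1).trans
          (mul_rotPerm_spec hn (hmemA hw).1 (hmemA hw).2).2
    _ = ∑ u ∈ A.image (· * rotPerm n hn), MvPowerSeries.coeff (xyExp n 1) (FP n u) :=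
        by
        rw [Finset.sum_image fun a _ b _ h => mul_right_cancel h]
    _ < ∑ w ∈ S, MvPowerSeries.coeff (xyExp n 1) (FP n w) :=
        Finset.sum_lt_sum_of_subset hsub (hmem.2 (extraPerm_spec hn).1) hextra
          (zero_lt_one.trans_le (extraPerm_spec hn).2) fun u _ _ => coeff_FP_nonneg n u _

theorem FC_Bn_not_poirier_positive (n : ℕ) (hn : 3 ≤ n) :
    ¬ ∃ c : (k : ℕ) → Nat.Partition k → Nat.Partition (n - k) → ℕ,
      (∑ᶠ w ∈ {w : Equiv.Perm ℤ | IsFC n w}, FP n w) =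
        ∑ k ∈ Finset.range (n + 1), ∑ μ : Nat.Partition k, ∑ ν : Nat.Partition (n - k),
          (c k μ ν : ℤ) • (schurX (partFun μ) * schurY (partFun ν)) := by
  rintro ⟨c, hc⟩
  rw [finsum_mem_eq_finite_toFinset_sum _ (finite_isFC n)] at hc
  refine (sum_coeff_FP_three_lt hn).ne ?_
  rw [← map_sum, ← map_sum, hc]
  simp only [map_sum]
  refine Finset.sum_congr rfl fun k _ => Finset.sum_congr rfl fun μ _ =>
    Finset.sum_congr rfl fun ν _ => ?_
  rw [map_zsmul, map_zsmul,
    coeff_xyExp_schur n μ ν (a := 3) (b := 1) (by norm_num) le_rfl]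

end Paper
end
end

section
/- Let n be a positive integer and let w∈B_n be fully commutative. Then the sequence w^0:=[−w_n,−w_{n−1},…,−w_1,w_1,…,w_n] contains no decreasing subsequence of length 4; that is, there are no positions p_1<p_2<p_3<p_4 in {1,…,2n} with w^0_{p_1}>w^0_{p_2}>w^0_{p_3}>w^0_{p_4}. -/
open scoped Classical

noncomputable section

namespace Paper

/-- On the right half, `w^0` is the window of `w`. -/
theorem wzero_add (n : ℕ) (w : Equiv.Perm ℤ) {i : ℕ} (hi : 1 ≤ i) :
    wzero n w (n + i) = w i := by
  rw [wzero, if_neg (by omega)]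
  congr 1
  push_cast
  ring

/-- On the left half, `w^0` is the negated reversed window of `w`. -/
theorem wzero_of_le (n : ℕ) (w : Equiv.Perm ℤ) {p : ℕ} (hp : p ≤ n) :
    wzero n w p = -w ((n + 1 - p : ℕ) : ℤ) := by
  rw [wzero, if_pos hp]
  congr 2
  omega

/-- The top of a descending pair in a fully commutative window is nonnegative. -/
theorem IsFC.nonneg_of_inversion {n : ℕ} {w : Equiv.Perm ℤ} (hw : IsFC n w) {i j : ℕ}
    (hi : 1 ≤ i) (hij : i < j) (hj : j ≤ n) (h : w j < w i) : 0 ≤ w i := by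
  by_contra! hneg
  exact hw.2.1 ⟨i, j, hi, hij, hj, h, hneg⟩

/-- The window of a fully commutative signed permutation avoids 321. -/
theorem IsFC.avoids321_s12 {n : ℕ} {w : Equiv.Perm ℤ} (hw : IsFC n w) : Avoids321 n w := by
  rintro ⟨i, j, k, hi, hij, hjk, hk, hkj, hji⟩
  exact hw.2.2.1 ⟨i, j, k, hi, hij, hjk, hk, hji.trans_le (le_abs_self _), hkj⟩

theorem no_decreasing_four (n : ℕ) (hn : 0 < n) (w : Equiv.Perm ℤ) (hw : IsFC n w) :
    ¬ ∃ p₁ p₂ p₃ p₄ : ℕ, 1 ≤ p₁ ∧ p₁ < p₂ ∧ p₂ < p₃ ∧ p₃ < p₄ ∧ p₄ ≤ 2 * n ∧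
      wzero n w p₂ < wzero n w p₁ ∧ wzero n w p₃ < wzero n w p₂ ∧
      wzero n w p₄ < wzero n w p₃ := by
  rintro ⟨p₁, p₂, p₃, p₄, h1, h12, h23, h34, h4, d12, d23, d34⟩
  by_cases hp3 : p₃ ≤ n
  · rw [wzero_of_le n w (by omega), wzero_of_le n w (by omega)] at d12 d23
    exact hw.avoids321_s12 ⟨n + 1 - p₃, n + 1 - p₂, n + 1 - p₁, by omega, by omega, by omega,
      by omega, neg_lt_neg_iff.mp d12, neg_lt_neg_iff.mp d23⟩
  obtain ⟨k, rfl⟩ := Nat.exists_eq_add_of_lt (not_le.mp hp3)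
  obtain ⟨l, rfl⟩ := Nat.exists_eq_add_of_lt (show n < p₄ by omega)
  rw [add_assoc, add_assoc, wzero_add n w (by omega), wzero_add n w (by omega)] at d34
  rw [add_assoc, wzero_add n w (by omega)] at d23
  by_cases hp2 : p₂ ≤ n
  · rw [wzero_of_le n w hp2, wzero_of_le n w (by omega)] at d12
    rw [wzero_of_le n w hp2] at d23
    have hleft := hw.nonneg_of_inversion (by omega) (by omega) (by omega)
      (neg_lt_neg_iff.mp d12)
    have hright := hw.nonneg_of_inversion (by omega) (by omega) (by omega) d34
    omega
  · obtain ⟨j, rfl⟩ := Nat.exists_eq_add_of_lt (not_le.mp hp2)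
    rw [add_assoc, wzero_add n w (by omega)] at d23
    exact hw.avoids321_s12 ⟨j + 1, k + 1, l + 1, by omega, by omega, by omega, by omega, d34, d23⟩

end Paper
end
end
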